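/- Let n ≥ 3 and c > 0. If u ∈ C^∞(ℝⁿ \ {0}) is positive and satisfies Δu(x) + (c/|x|²) u(x) + u(x)^{(n+2)/(n−2)} = 0 for all x ∈ ℝⁿ \ {0}, then u is radially symmetric about the origin; moreover, writing u(x) = ū(|x|) for a function ū on (0,∞), one has ū'(r) < 0 for all 0 < r < ∞, and there exists a positive constant C such that u(x) ≤ C |x|^{−(n−2)/2} for all x ∈ ℝⁿ \ {0}. -/

import Mathlib

open scoped BigOperators

/-- The Euclidean Laplacian of `u : ℝⁿ → ℝ` at `x`, as the sum of the pure second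
derivatives in the standard coordinate directions. -/
noncomputable def eLaplacian {n : ℕ} (u : EuclideanSpace ℝ (Fin n) → ℝ)
    (x : EuclideanSpace ℝ (Fin n)) : ℝ :=
  ∑ i : Fin n, iteratedFDeriv ℝ 2 u x ![EuclideanSpace.single i 1, EuclideanSpace.single i 1]

open Filter Topology Set

section Calculus

variable {n : ℕ}

/-- The pure second derivative of a `C²` function, computed along a line. -/
lemma iteratedFDeriv_two_eq_of_line {E : Type*} [NormedAddCommGroup E] [NormedSpace ℝ E]
    {f : E → ℝ} {z e : E} (hf : ContDiffAt ℝ 2 f z) {φ : ℝ → ℝ} {d : ℝ}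
    (h1 : ∀ᶠ t in 𝓝 (0 : ℝ), HasDerivAt (fun t : ℝ => f (z + t • e)) (φ t) t)
    (h2 : HasDerivAt φ d 0) : iteratedFDeriv ℝ 2 f z ![e, e] = d := by
  rw [iteratedFDeriv_two_apply]
  have hline : ∀ t : ℝ, HasDerivAt (fun t : ℝ => z + t • e) e t := fun t => by
    simpa using ((hasDerivAt_id t).smul_const e).const_add z
  have hcont : Tendsto (fun t : ℝ => z + t • e) (𝓝 0) (𝓝 z) := by
    have := (hline 0).continuousAt.tendsto
    simpa using this
  have hev : ∀ᶠ t in 𝓝 (0 : ℝ), φ t = fderiv ℝ f (z + t • e) e := by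
    have h3 : ∀ᶠ y in 𝓝 z, ContDiffAt ℝ 2 f y := hf.eventually (by simp)
    filter_upwards [h1, hcont.eventually h3] with t ht hft
    have h4 : DifferentiableAt ℝ f (z + t • e) := hft.differentiableAt (by norm_num)
    exact ht.unique (h4.hasFDerivAt.comp_hasDerivAt t (hline t))
  have hd : DifferentiableAt ℝ (fderiv ℝ f) z :=
    (hf.fderiv_right (m := 1) (by norm_num)).differentiableAt (by norm_num)
  have hd' : HasFDerivAt (fderiv ℝ f) (fderiv ℝ (fderiv ℝ f) z) (z + (0 : ℝ) • e) := by
    simpa using hd.hasFDerivAt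
  have h4 : HasDerivAt (fun t : ℝ => fderiv ℝ f (z + t • e) e)
      (fderiv ℝ (fderiv ℝ f) z e e) 0 := by
    have h5 : HasDerivAt (fun t : ℝ => fderiv ℝ f (z + t • e)) (fderiv ℝ (fderiv ℝ f) z e) 0 :=
      hd'.comp_hasDerivAt (0 : ℝ) (hline 0)
    simpa using h5.clm_apply (hasDerivAt_const (0 : ℝ) e)
  simpa using (h4.congr_of_eventuallyEq hev).unique h2

/-- First and second order expansion of `ω(t) v(γ(t))`. -/
lemma hasDerivAt_smul_comp_curve {E : Type*} [NormedAddCommGroup E] [NormedSpace ℝ E]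
    {v : E → ℝ} {γ γ' : ℝ → E} {γ'' : E} {ω ω' : ℝ → ℝ} {ω'' : ℝ}
    (hv : ContDiffAt ℝ 2 v (γ 0))
    (hγ : ∀ᶠ t in 𝓝 (0 : ℝ), HasDerivAt γ (γ' t) t) (hγ' : HasDerivAt γ' γ'' 0)
    (hω : ∀ᶠ t in 𝓝 (0 : ℝ), HasDerivAt ω (ω' t) t) (hω' : HasDerivAt ω' ω'' 0) :
    (∀ᶠ t in 𝓝 (0 : ℝ), HasDerivAt (fun t => ω t * v (γ t))
      (ω' t * v (γ t) + ω t * fderiv ℝ v (γ t) (γ' t)) t) ∧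
    HasDerivAt (fun t => ω' t * v (γ t) + ω t * fderiv ℝ v (γ t) (γ' t))
      (ω'' * v (γ 0) + 2 * ω' 0 * fderiv ℝ v (γ 0) (γ' 0) +
        ω 0 * (fderiv ℝ (fderiv ℝ v) (γ 0) (γ' 0) (γ' 0) + fderiv ℝ v (γ 0) γ'')) 0 := by
  have hγ0 := hγ.self_of_nhds
  have hω0 := hω.self_of_nhds
  have hcv : ∀ᶠ t in 𝓝 (0 : ℝ), ContDiffAt ℝ 2 v (γ t) :=
    hγ0.continuousAt.eventually (hv.eventually (by simp))
  have hd : DifferentiableAt ℝ (fderiv ℝ v) (γ 0) :=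
    (hv.fderiv_right (m := 1) (by norm_num)).differentiableAt (by norm_num)
  have hv1 : HasDerivAt (fun t => v (γ t)) (fderiv ℝ v (γ 0) (γ' 0)) 0 :=
    (hv.differentiableAt (by norm_num)).hasFDerivAt.comp_hasDerivAt 0 hγ0
  refine ⟨?_, ?_⟩
  · filter_upwards [hγ, hω, hcv] with t h1 h2 h3
    exact h2.mul ((h3.differentiableAt (by norm_num)).hasFDerivAt.comp_hasDerivAt t h1)
  · have h5 := (hd.hasFDerivAt.comp_hasDerivAt (0 : ℝ) hγ0).clm_apply hγ'
    have h6 := (hω'.mul hv1).add (hω0.mul h5)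
    refine h6.congr_deriv ?_
    simp only [Function.comp]
    ring

lemma eLaplacian_add {f g : EuclideanSpace ℝ (Fin n) → ℝ} {z : EuclideanSpace ℝ (Fin n)}
    (hf : ContDiffAt ℝ 2 f z) (hg : ContDiffAt ℝ 2 g z) :
    eLaplacian (fun y => f y + g y) z = eLaplacian f z + eLaplacian g z := by
  have : (fun y => f y + g y) = f + g := rfl
  simp [eLaplacian, this, iteratedFDeriv_add_apply hf hg, Finset.sum_add_distrib]

lemma eLaplacian_const_mul {f : EuclideanSpace ℝ (Fin n) → ℝ} {z : EuclideanSpace ℝ (Fin n)}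
    (m : ℝ) (hf : ContDiffAt ℝ 2 f z) :
    eLaplacian (fun y => m * f y) z = m * eLaplacian f z := by
  have : (fun y => m * f y) = m • f := rfl
  simp [eLaplacian, this, iteratedFDeriv_const_smul_apply hf, Finset.mul_sum]

lemma eLaplacian_sub {f g : EuclideanSpace ℝ (Fin n) → ℝ} {z : EuclideanSpace ℝ (Fin n)}
    (hf : ContDiffAt ℝ 2 f z) (hg : ContDiffAt ℝ 2 g z) :
    eLaplacian (fun y => f y - g y) z = eLaplacian f z - eLaplacian g z := by
  have : (fun y => f y - g y) = f - g := rfl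
  simp [eLaplacian, this, iteratedFDeriv_sub_apply hf hg, Finset.sum_sub_distrib]

lemma eLaplacian_comp_add_left (f : EuclideanSpace ℝ (Fin n) → ℝ)
    (x z : EuclideanSpace ℝ (Fin n)) :
    eLaplacian (fun y => f (x + y)) z = eLaplacian f (x + z) := by
  simp [eLaplacian, iteratedFDeriv_comp_add_left]

/-- Second derivative test: the Laplacian is nonnegative at a local minimum. -/
lemma eLaplacian_nonneg_of_isLocalMin {f : EuclideanSpace ℝ (Fin n) → ℝ}
    {z : EuclideanSpace ℝ (Fin n)} (hf : ContDiffAt ℝ 2 f z) (hmin : IsLocalMin f z) :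
    0 ≤ eLaplacian f z := by
  refine Finset.sum_nonneg fun i _ => ?_
  set e : EuclideanSpace ℝ (Fin n) := EuclideanSpace.single i 1
  by_contra! hneg
  have hline : ∀ t : ℝ, HasDerivAt (fun t : ℝ => z + t • e) e t := fun t => by
    simpa using ((hasDerivAt_id t).smul_const e).const_add z
  have hz : z + (0 : ℝ) • e = z := by simp
  obtain ⟨h1, h2⟩ := hasDerivAt_smul_comp_curve (v := f) (γ := fun t : ℝ => z + t • e)
    (γ' := fun _ => e) (γ'' := 0) (ω := fun _ => 1) (ω' := fun _ => 0) (ω'' := 0)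
    (by simpa using hf) (Eventually.of_forall hline) (hasDerivAt_const _ _)
    (Eventually.of_forall fun t => hasDerivAt_const _ _) (hasDerivAt_const _ _)
  simp only [one_mul] at h1 h2
  have hd := iteratedFDeriv_two_eq_of_line hf h1 h2
  set h : ℝ → ℝ := fun t => f (z + t • e)
  have hdh := h1.mono fun t ht => ht.deriv
  have hdd : deriv (deriv h) 0 < 0 := by
    rw [EventuallyEq.deriv_eq hdh, h2.deriv, ← hd]
    exact hneg
  have hlmin : IsLocalMin h 0 := by
    have : Tendsto (fun t : ℝ => z + t • e) (𝓝 0) (𝓝 z) := by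
      simpa using (hline 0).continuousAt.tendsto
    have h4 := this.eventually hmin
    filter_upwards [h4] with t ht
    simpa [h] using ht
  have hlmax : IsLocalMax h 0 :=
    isLocalMax_of_deriv_deriv_neg hdd hlmin.deriv_eq_zero h1.self_of_nhds.continuousAt
  have hconst : h =ᶠ[𝓝 0] fun _ => h 0 := by
    filter_upwards [hlmin, hlmax] with t h5 h6 using le_antisymm h6 h5
  have h7 : deriv h =ᶠ[𝓝 0] fun _ => 0 := by
    simpa using hconst.deriv
  rw [h7.deriv_eq] at hdd
  simp at hdd

/-- A maximum principle on a compact set in the presence of a strict positive supersolution. -/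
lemma nonneg_of_strict_supersolution {K : Set (EuclideanSpace ℝ (Fin n))} (hK : IsCompact K)
    {w φ : EuclideanSpace ℝ (Fin n) → ℝ} (hw : ContinuousOn w K) (hφ : ContinuousOn φ K)
    (hφpos : ∀ z ∈ K, 0 < φ z)
    (h : ∀ z ∈ K, w z < 0 → K ∈ 𝓝 z ∧ ContDiffAt ℝ 2 w z ∧ ContDiffAt ℝ 2 φ z ∧
      ∃ κ : ℝ, eLaplacian w z + κ * w z ≤ 0 ∧ eLaplacian φ z + κ * φ z < 0) :
    ∀ z ∈ K, 0 ≤ w z := by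
  intro y hy
  obtain ⟨z, hzK, hz⟩ := hK.exists_isMinOn ⟨y, hy⟩
    (hw.div hφ fun z hz => (hφpos z hz).ne')
  by_contra! hneg
  set m := w z / φ z with hm
  have hm0 : m < 0 := lt_of_le_of_lt (hz hy) (div_neg_of_neg_of_pos hneg (hφpos y hy))
  have hwz : w z = m * φ z := by rw [hm, div_mul_cancel₀ _ (hφpos z hzK).ne']
  obtain ⟨hnhds, hwd, hφd, κ, h1, h2⟩ := h z hzK (by
    rw [hwz]; exact mul_neg_of_neg_of_pos hm0 (hφpos z hzK))
  have hmin : IsLocalMin (fun y => w y - m * φ y) z := by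
    filter_upwards [hnhds] with y hy
    have : m ≤ w y / φ y := hz hy
    rw [le_div_iff₀ (hφpos y hy)] at this
    simp only [hwz]
    linarith
  have h3 := eLaplacian_nonneg_of_isLocalMin (hwd.sub (contDiffAt_const.mul hφd)) hmin
  rw [eLaplacian_sub hwd (contDiffAt_const.mul hφd), eLaplacian_const_mul _ hφd] at h3
  rw [hwz] at h1
  nlinarith [mul_pos_of_neg_of_neg hm0 h2]

lemma norm_add_smul_single_sq (z : EuclideanSpace ℝ (Fin n)) (i : Fin n) (t : ℝ) :
    ‖z + t • EuclideanSpace.single i (1 : ℝ)‖ ^ 2 = ‖z‖ ^ 2 + 2 * z i * t + t ^ 2 := by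
  rw [@norm_add_sq_real, inner_smul_right, norm_smul, EuclideanSpace.inner_single_right]
  simp
  ring

lemma hasDerivAt_quadratic (s b t : ℝ) :
    HasDerivAt (fun t : ℝ => s + 2 * b * t + t ^ 2) (2 * b + 2 * t) t := by
  have := (((hasDerivAt_id t).const_mul (2 * b)).const_add s).add ((hasDerivAt_id t).pow 2)
  refine this.congr_deriv ?_
  simp

lemma sum_sq_eq (z : EuclideanSpace ℝ (Fin n)) : ∑ i, z i ^ 2 = ‖z‖ ^ 2 := by
  simp [EuclideanSpace.norm_sq_eq]

/-- The Laplacian of a radial function `y ↦ g (‖y - a‖²)`. -/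
lemma eLaplacian_comp_norm_sub_sq {g g' : ℝ → ℝ} {g'' : ℝ} {a z : EuclideanSpace ℝ (Fin n)}
    (hf : ContDiffAt ℝ 2 (fun y => g (‖y - a‖ ^ 2)) z)
    (hg : ∀ᶠ s in 𝓝 (‖z - a‖ ^ 2), HasDerivAt g (g' s) s)
    (hg' : HasDerivAt g' g'' (‖z - a‖ ^ 2)) :
    eLaplacian (fun y => g (‖y - a‖ ^ 2)) z =
      4 * ‖z - a‖ ^ 2 * g'' + 2 * n * g' (‖z - a‖ ^ 2) := by
  have key : ∀ i : Fin n, iteratedFDeriv ℝ 2 (fun y => g (‖y - a‖ ^ 2)) z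
      ![EuclideanSpace.single i 1, EuclideanSpace.single i 1] =
      4 * (z - a) i ^ 2 * g'' + 2 * g' (‖z - a‖ ^ 2) := by
    intro i
    set s := ‖z - a‖ ^ 2
    set b := (z - a) i
    have hq := hasDerivAt_quadratic s b
    have hq0 : s + 2 * b * 0 + 0 ^ 2 = s := by ring
    have e1 : (fun t : ℝ => g (‖z + t • EuclideanSpace.single i (1 : ℝ) - a‖ ^ 2)) =
        fun t => g (s + 2 * b * t + t ^ 2) := by
      funext t
      rw [show z + t • EuclideanSpace.single i (1 : ℝ) - a =
        (z - a) + t • EuclideanSpace.single i (1 : ℝ) by abel, norm_add_smul_single_sq]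
    refine iteratedFDeriv_two_eq_of_line hf
      (φ := fun t => g' (s + 2 * b * t + t ^ 2) * (2 * b + 2 * t)) ?_ ?_
    · rw [e1]
      have hc := (hq 0).continuousAt.tendsto
      rw [hq0] at hc
      filter_upwards [hc.eventually hg] with t ht
      exact ht.comp t (hq t)
    · have h1 : HasDerivAt (fun t => g' (s + 2 * b * t + t ^ 2)) (g'' * (2 * b + 2 * 0)) 0 := by
        refine HasDerivAt.comp (0 : ℝ) (h₂ := g') ?_ (hq 0)
        rwa [hq0]
      have h2 : HasDerivAt (fun t : ℝ => 2 * b + 2 * t) 2 0 := by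
        simpa using ((hasDerivAt_id (0 : ℝ)).const_mul 2).const_add (2 * b)
      refine (h1.mul h2).congr_deriv ?_
      simp only [hq0]
      ring
  simp only [eLaplacian, key, Finset.sum_add_distrib, ← Finset.sum_mul, ← Finset.mul_sum,
    sum_sq_eq, Finset.sum_const, Finset.card_univ, Fintype.card_fin, nsmul_eq_mul]
  ring

end Calculus

section Kelvin

variable {n : ℕ}

lemma sum_mul_apply_single (z : EuclideanSpace ℝ (Fin n)) (L : EuclideanSpace ℝ (Fin n) →L[ℝ] ℝ) :
    ∑ i, z i * L (EuclideanSpace.single i 1) = L z := by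
  conv_rhs => rw [← (EuclideanSpace.basisFun (Fin n) ℝ).sum_repr z]
  simp [map_sum]

/-- The Kelvin transform of `v` with respect to the sphere of radius `l` centred at the origin. -/
noncomputable def kelvin (v : EuclideanSpace ℝ (Fin n) → ℝ) (l : ℝ)
    (z : EuclideanSpace ℝ (Fin n)) : ℝ :=
  (l / ‖z‖) ^ (n - 2) * v ((l ^ 2 / ‖z‖ ^ 2) • z)

lemma contDiffAt_kelvin {v : EuclideanSpace ℝ (Fin n) → ℝ} {l : ℝ}
    {z : EuclideanSpace ℝ (Fin n)} (hz : z ≠ 0)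
    (hv : ContDiffAt ℝ 2 v ((l ^ 2 / ‖z‖ ^ 2) • z)) : ContDiffAt ℝ 2 (kelvin v l) z := by
  have h1 : ContDiffAt ℝ 2 (fun z : EuclideanSpace ℝ (Fin n) => ‖z‖) z := contDiffAt_norm ℝ hz
  have hz' : ‖z‖ ≠ 0 := norm_ne_zero_iff.2 hz
  refine ContDiffAt.mul ((contDiffAt_const.div h1 hz').pow _) ?_
  exact ContDiffAt.comp (f := fun z : EuclideanSpace ℝ (Fin n) => (l ^ 2 / ‖z‖ ^ 2) • z) z hv
    ((contDiffAt_const.div (h1.pow 2) (pow_ne_zero 2 hz')).smul contDiffAt_id)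

lemma div_pow_eq_mul_rpow {l r : ℝ} (hr : 0 < r) (k : ℕ) :
    (l / r) ^ k = l ^ k * (r ^ 2) ^ (-(k : ℝ) / 2) := by
  rw [← Real.rpow_natCast r 2, ← Real.rpow_mul hr.le, div_pow, div_eq_mul_inv]
  congr 1
  rw [← Real.rpow_natCast, ← Real.rpow_neg hr.le]
  congr 1
  push_cast
  ring

lemma hasDerivAt_rpow_quadratic {s b t : ℝ} (c p : ℝ) (h : 0 < s + 2 * b * t + t ^ 2) :
    HasDerivAt (fun t : ℝ => c * (s + 2 * b * t + t ^ 2) ^ p)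
      (c * p * (s + 2 * b * t + t ^ 2) ^ (p - 1) * (2 * b + 2 * t)) t := by
  have := ((hasDerivAt_quadratic s b t).rpow_const (p := p) (Or.inl h.ne')).const_mul c
  refine this.congr_deriv ?_
  ring

/-- Pure second derivatives of the Kelvin transform. -/
lemma iteratedFDeriv_kelvin {v : EuclideanSpace ℝ (Fin n) → ℝ} {l : ℝ}
    {z : EuclideanSpace ℝ (Fin n)} (hz : z ≠ 0)
    (hv : ContDiffAt ℝ 2 v ((l ^ 2 / ‖z‖ ^ 2) • z)) (i : Fin n) {p k s : ℝ}
    (hp : p = -((n - 2 : ℕ) : ℝ) / 2) (hk : k = l ^ (n - 2)) (hs : s = ‖z‖ ^ 2)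
    {L : EuclideanSpace ℝ (Fin n) →L[ℝ] ℝ}
    {B : EuclideanSpace ℝ (Fin n) →L[ℝ] EuclideanSpace ℝ (Fin n) →L[ℝ] ℝ}
    (hL : L = fderiv ℝ v ((l ^ 2 / ‖z‖ ^ 2) • z))
    (hB : B = fderiv ℝ (fderiv ℝ v) ((l ^ 2 / ‖z‖ ^ 2) • z)) :
    iteratedFDeriv ℝ 2 (kelvin v l) z ![EuclideanSpace.single i 1, EuclideanSpace.single i 1] =
      k * p * ((p - 1) * s ^ (p - 2) * (4 * z i ^ 2) + s ^ (p - 1) * 2) *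
        v ((l ^ 2 / ‖z‖ ^ 2) • z) +
      2 * (k * p * s ^ (p - 1) * (2 * z i)) *
        L ((-(2 * l ^ 2 * z i) / s ^ 2) • z + (l ^ 2 / s) • EuclideanSpace.single i 1) +
      k * s ^ p * (
        B ((-(2 * l ^ 2 * z i) / s ^ 2) • z + (l ^ 2 / s) • EuclideanSpace.single i 1)
          ((-(2 * l ^ 2 * z i) / s ^ 2) • z + (l ^ 2 / s) • EuclideanSpace.single i 1) +
        L ((-(2 * l ^ 2) / s ^ 2 + 8 * l ^ 2 * z i ^ 2 / s ^ 3) • z +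
          (2 * (-(2 * l ^ 2 * z i) / s ^ 2)) • EuclideanSpace.single i 1)) := by
  set e : EuclideanSpace ℝ (Fin n) := EuclideanSpace.single i 1 with he
  set b := z i with hb
  have hs0 : 0 < s := by rw [hs]; positivity
  set q : ℝ → ℝ := fun t => s + 2 * b * t + t ^ 2 with hq
  have hq0 : q 0 = s := by simp [hq]
  have hqd : ∀ t, HasDerivAt q (2 * b + 2 * t) t := hasDerivAt_quadratic s b
  have hqd' : HasDerivAt (fun t : ℝ => 2 * b + 2 * t) 2 0 := by
    simpa using ((hasDerivAt_id (0 : ℝ)).const_mul 2).const_add (2 * b)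
  have hqpos : ∀ᶠ t in 𝓝 (0 : ℝ), 0 < q t :=
    (hqd 0).continuousAt.eventually (lt_mem_nhds (by rw [hq0]; exact hs0))
  have hline : ∀ t : ℝ, HasDerivAt (fun t : ℝ => z + t • e) e t := fun t => by
    simpa using ((hasDerivAt_id t).smul_const e).const_add z
  set A : ℝ → ℝ := fun t => l ^ 2 / q t with hA
  set A' : ℝ → ℝ := fun t => -(l ^ 2 * (2 * b + 2 * t)) / q t ^ 2 with hA'
  have hAd : ∀ t, 0 < q t → HasDerivAt A (A' t) t := fun t ht => by
    have := (hasDerivAt_const t (l ^ 2)).div (hqd t) ht.ne'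
    refine this.congr_deriv ?_
    simp [hA']
  have hA'd : HasDerivAt A' (-(2 * l ^ 2) / s ^ 2 + 8 * l ^ 2 * b ^ 2 / s ^ 3) 0 := by
    have := ((hqd'.const_mul (l ^ 2)).neg).div ((hqd 0).pow 2) (by rw [Pi.pow_apply, hq0]; positivity)
    refine this.congr_deriv ?_
    simp only [Pi.pow_apply, Pi.neg_apply, hq0]
    field_simp
    ring
  set γ : ℝ → EuclideanSpace ℝ (Fin n) := fun t => A t • (z + t • e) with hγ
  set γ' : ℝ → EuclideanSpace ℝ (Fin n) := fun t => A' t • (z + t • e) + A t • e with hγ'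
  have hγ0 : γ 0 = (l ^ 2 / ‖z‖ ^ 2) • z := by simp [hγ, hA, hq0, hs]
  have hγ'0 : γ' 0 = (-(2 * l ^ 2 * b) / s ^ 2) • z + (l ^ 2 / s) • e := by
    simp only [hγ', hA', hA, hq0, zero_smul, add_zero, mul_zero]
    congr 3
    ring
  have hγd : ∀ᶠ t in 𝓝 (0 : ℝ), HasDerivAt γ (γ' t) t := by
    filter_upwards [hqpos] with t ht
    refine ((hAd t ht).smul (hline t)).congr_deriv ?_
    simp only [hγ']
    abel
  have hγ'd : HasDerivAt γ' ((-(2 * l ^ 2) / s ^ 2 + 8 * l ^ 2 * b ^ 2 / s ^ 3) • z +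
      (2 * (-(2 * l ^ 2 * b) / s ^ 2)) • e) 0 := by
    have h1 := (hA'd.smul (hline 0)).add
      ((hAd 0 (by rw [hq0]; exact hs0)).smul (hasDerivAt_const (0 : ℝ) e))
    refine h1.congr_deriv ?_
    simp only [hA', hA, hq0, zero_smul, add_zero, mul_zero, smul_zero, zero_add]
    module
  set ω : ℝ → ℝ := fun t => k * q t ^ p with hω
  set ω' : ℝ → ℝ := fun t => k * p * q t ^ (p - 1) * (2 * b + 2 * t) with hω'
  have hωd : ∀ᶠ t in 𝓝 (0 : ℝ), HasDerivAt ω (ω' t) t := by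
    filter_upwards [hqpos] with t ht
    exact hasDerivAt_rpow_quadratic k p ht
  have hω'd : HasDerivAt ω' (k * p * ((p - 1) * s ^ (p - 2) * (4 * b ^ 2) + s ^ (p - 1) * 2)) 0 := by
    have h1 := (hasDerivAt_rpow_quadratic (s := s) (b := b) (t := 0) (k * p) (p - 1)
      (by simpa using hs0)).mul hqd'
    refine h1.congr_deriv ?_
    simp only [mul_zero, add_zero, ne_eq, OfNat.ofNat_ne_zero, not_false_eq_true, zero_pow]
    rw [show p - 1 - 1 = p - 2 by ring]
    ring
  obtain ⟨h1, h2⟩ := hasDerivAt_smul_comp_curve (v := v) (by rw [hγ0]; exact hv) hγd hγ'd hωd hω'd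
  have hF : (fun t : ℝ => kelvin v l (z + t • e)) =ᶠ[𝓝 0] fun t => ω t * v (γ t) := by
    filter_upwards [hqpos] with t ht
    have hnorm : ‖z + t • e‖ ^ 2 = q t := by rw [norm_add_smul_single_sq, ← hs]
    have hpos : 0 < ‖z + t • e‖ := by
      rcases (norm_nonneg (z + t • e)).eq_or_lt with h | h
      · rw [← h] at hnorm
        norm_num at hnorm
        exact absurd hnorm ht.ne
      · exact h
    simp only [kelvin, div_pow_eq_mul_rpow hpos, hnorm, hω, hγ, hA, hk, hp]
  have h3 : ∀ᶠ t in 𝓝 (0 : ℝ), HasDerivAt (fun t : ℝ => kelvin v l (z + t • e))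
      (ω' t * v (γ t) + ω t * fderiv ℝ v (γ t) (γ' t)) t := by
    filter_upwards [h1, hF.eventually_nhds] with t h4 h5
    exact h4.congr_of_eventuallyEq h5
  rw [iteratedFDeriv_two_eq_of_line (contDiffAt_kelvin hz hv) h3 h2, hγ'0, hγ0, hL, hB]
  simp only [hω, hω', hq0, mul_zero, add_zero]

/-- Conformal covariance of the Laplacian under the Kelvin transform. -/
lemma eLaplacian_kelvin (hn : 2 ≤ n) {v : EuclideanSpace ℝ (Fin n) → ℝ} {l : ℝ}
    {z : EuclideanSpace ℝ (Fin n)} (hz : z ≠ 0)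
    (hv : ContDiffAt ℝ 2 v ((l ^ 2 / ‖z‖ ^ 2) • z)) :
    eLaplacian (kelvin v l) z =
      (l / ‖z‖) ^ (n + 2) * eLaplacian v ((l ^ 2 / ‖z‖ ^ 2) • z) := by
  have hr : 0 < ‖z‖ := norm_pos_iff.2 hz
  obtain ⟨s, hs⟩ : ∃ s, s = ‖z‖ ^ 2 := ⟨_, rfl⟩
  have hs0 : 0 < s := by rw [hs]; positivity
  obtain ⟨p, hp⟩ : ∃ p : ℝ, p = -((n - 2 : ℕ) : ℝ) / 2 := ⟨_, rfl⟩
  have hnp : (n : ℝ) = 2 - 2 * p := by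
    rw [hp, Nat.cast_sub hn]; push_cast; ring
  have hP1 : s ^ (p - 1) = s ^ (p - 2) * s := by
    rw [← Real.rpow_add_one hs0.ne']; congr 1; ring
  have hP0 : s ^ p = s ^ (p - 2) * s ^ 2 := by
    rw [← Real.rpow_natCast s 2, ← Real.rpow_add hs0]; congr 1; push_cast; ring
  have hC : (l / ‖z‖) ^ (n + 2) = l ^ (n - 2) * l ^ 4 * s ^ (p - 2) := by
    rw [div_pow_eq_mul_rpow hr, ← hs, ← pow_add]
    congr 2
    · omega
    · push_cast; rw [hnp]; ring
  obtain ⟨L, hL⟩ : ∃ L, L = fderiv ℝ v ((l ^ 2 / ‖z‖ ^ 2) • z) := ⟨_, rfl⟩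
  obtain ⟨B, hB⟩ : ∃ B, B = fderiv ℝ (fderiv ℝ v) ((l ^ 2 / ‖z‖ ^ 2) • z) := ⟨_, rfl⟩
  have hΔ : eLaplacian v ((l ^ 2 / ‖z‖ ^ 2) • z) =
      ∑ i : Fin n, B (EuclideanSpace.single i 1) (EuclideanSpace.single i 1) := by
    simp [eLaplacian, iteratedFDeriv_two_apply, hB]
  have e1 := sum_mul_apply_single z L
  have e2 := sum_mul_apply_single z (B z)
  have e3 : ∑ i, z i * B (EuclideanSpace.single i 1) z = B z z := sum_mul_apply_single z (B.flip z)
  have e4 := sum_sq_eq z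
  rw [← hs] at e4
  rw [hC, hΔ]
  unfold eLaplacian
  rw [Finset.sum_congr rfl fun i _ => iteratedFDeriv_kelvin hz hv i hp rfl hs hL hB]
  set V := v ((l ^ 2 / ‖z‖ ^ 2) • z)
  set k := l ^ (n - 2)
  set P := s ^ (p - 2)
  have hterm : ∀ i : Fin n,
      k * p * ((p - 1) * P * (4 * z i ^ 2) + s ^ (p - 1) * 2) * V +
      2 * (k * p * s ^ (p - 1) * (2 * z i)) *
        L ((-(2 * l ^ 2 * z i) / s ^ 2) • z + (l ^ 2 / s) • EuclideanSpace.single i 1) +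
      k * s ^ p * (
        B ((-(2 * l ^ 2 * z i) / s ^ 2) • z + (l ^ 2 / s) • EuclideanSpace.single i 1)
          ((-(2 * l ^ 2 * z i) / s ^ 2) • z + (l ^ 2 / s) • EuclideanSpace.single i 1) +
        L ((-(2 * l ^ 2) / s ^ 2 + 8 * l ^ 2 * z i ^ 2 / s ^ 3) • z +
          (2 * (-(2 * l ^ 2 * z i) / s ^ 2)) • EuclideanSpace.single i 1)) =
      (2 * k * p * P * s * V - 2 * k * P * l ^ 2 * L z) +
      (4 * k * p * (p - 1) * P * V + (8 - 8 * p) * k * P * l ^ 2 / s * L z +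
        4 * k * P * l ^ 4 / s ^ 2 * B z z) * z i ^ 2 +
      (4 * p - 4) * k * P * l ^ 2 * (z i * L (EuclideanSpace.single i 1)) +
      (-2 * k * P * l ^ 4 / s) * (z i * B z (EuclideanSpace.single i 1)) +
      (-2 * k * P * l ^ 4 / s) * (z i * B (EuclideanSpace.single i 1) z) +
      k * l ^ 4 * P * B (EuclideanSpace.single i 1) (EuclideanSpace.single i 1) := by
    intro i
    rw [hP1, hP0]
    simp only [map_add, map_smul, add_apply, smul_apply,
      smul_eq_mul]
    field_simp
    ring
  rw [Finset.sum_congr rfl fun i _ => hterm i]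
  simp only [Finset.sum_add_distrib, ← Finset.mul_sum, e1, e2, e3, e4, Finset.sum_const,
    Finset.card_univ, Fintype.card_fin, nsmul_eq_mul, hnp]
  field_simp
  ring

end Kelvin

section Exterior

variable {n : ℕ}

lemma contDiffAt_norm_sub_sq_rpow {a z : EuclideanSpace ℝ (Fin n)} (hz : z ≠ a) (p : ℝ) :
    ContDiffAt ℝ 2 (fun y : EuclideanSpace ℝ (Fin n) => (‖y - a‖ ^ 2) ^ p) z := by
  have h0 : ‖z - a‖ ^ 2 ≠ 0 := pow_ne_zero 2 (norm_ne_zero_iff.2 (sub_ne_zero.2 hz))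
  exact ((contDiffAt_id.sub contDiffAt_const).norm_sq ℝ).rpow_const_of_ne h0

lemma eLaplacian_norm_sub_sq_rpow {a z : EuclideanSpace ℝ (Fin n)} (hz : z ≠ a) (p : ℝ) :
    eLaplacian (fun y : EuclideanSpace ℝ (Fin n) => (‖y - a‖ ^ 2) ^ p) z =
      2 * p * (2 * p - 2 + n) * (‖z - a‖ ^ 2) ^ (p - 1) := by
  have h0 : 0 < ‖z - a‖ ^ 2 := pow_pos (norm_pos_iff.2 (sub_ne_zero.2 hz)) 2
  have hder : ∀ q s : ℝ, 0 < s → HasDerivAt (fun s : ℝ => s ^ q) (q * s ^ (q - 1)) s :=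
    fun q s hs => Real.hasDerivAt_rpow_const (Or.inl hs.ne')
  rw [eLaplacian_comp_norm_sub_sq (g := fun s => s ^ p) (g' := fun s => p * s ^ (p - 1))
    (contDiffAt_norm_sub_sq_rpow hz p)
    ((lt_mem_nhds h0).mono fun s hs => hder p s hs) ((hder (p - 1) _ h0).const_mul p)]
  have : (‖z - a‖ ^ 2) ^ (p - 1) = (‖z - a‖ ^ 2) ^ (p - 1 - 1) * ‖z - a‖ ^ 2 := by
    rw [← Real.rpow_add_one h0.ne']; congr 1; ring
  rw [this]
  ring

/-- A nonnegative superharmonic function outside a ball, with an isolated singularity at `a`,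
dominates the fundamental solution. -/
lemma superharmonic_lower_bound (hn : 3 ≤ n) {a : EuclideanSpace ℝ (Fin n)} {R m : ℝ}
    (hR : 0 < R) (hm : 0 < m) {w : EuclideanSpace ℝ (Fin n) → ℝ}
    (hw : ∀ z, R ≤ ‖z‖ → z ≠ a → ContDiffAt ℝ 2 w z)
    (hw0 : ∀ z, R ≤ ‖z‖ → z ≠ a → 0 ≤ w z)
    (hΔ : ∀ z, R ≤ ‖z‖ → z ≠ a → eLaplacian w z ≤ 0)
    (hb : ∀ z, ‖z‖ = R → z ≠ a → m ≤ w z) :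
    ∀ z, R ≤ ‖z‖ → z ≠ a → m * (R / ‖z‖) ^ (n - 2) ≤ w z := by
  intro z₀ hz₀ hz₀a
  obtain ⟨p, hp⟩ : ∃ p : ℝ, p = -((n - 2 : ℕ) : ℝ) / 2 := ⟨_, rfl⟩
  have hnp : 2 * p - 2 + n = 0 := by
    rw [hp, Nat.cast_sub (by omega)]; push_cast; ring
  set g : EuclideanSpace ℝ (Fin n) → ℝ := fun y => 1 + (‖y - a‖ ^ 2) ^ (-(1 / 4) : ℝ) with hg
  set f : EuclideanSpace ℝ (Fin n) → ℝ := fun y => m * R ^ (n - 2) * (‖y - 0‖ ^ 2) ^ p with hf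
  have hfe : ∀ y, y ≠ 0 → f y = m * (R / ‖y‖) ^ (n - 2) := fun y hy => by
    rw [div_pow_eq_mul_rpow (norm_pos_iff.2 hy), hf, ← hp]
    simp only [sub_zero]
    ring
  have hgpos : ∀ y, 1 ≤ g y := fun y => by
    simp only [hg]
    have : (0 : ℝ) ≤ (‖y - a‖ ^ 2) ^ (-(1 / 4) : ℝ) := by positivity
    linarith
  have hne : ∀ y : EuclideanSpace ℝ (Fin n), R ≤ ‖y‖ → y ≠ 0 := fun y hy h => by
    rw [h, norm_zero] at hy; linarith
  have hgd : ∀ y, y ≠ a → ContDiffAt ℝ 2 g y := fun y hy =>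
    contDiffAt_const.add (contDiffAt_norm_sub_sq_rpow hy _)
  have hfd : ∀ y, y ≠ 0 → ContDiffAt ℝ 2 f y := fun y hy =>
    contDiffAt_const.mul (contDiffAt_norm_sub_sq_rpow hy _)
  have hΔg : ∀ y, y ≠ a → eLaplacian g y < 0 := fun y hy => by
    have h1 : eLaplacian (fun _ : EuclideanSpace ℝ (Fin n) => (1 : ℝ)) y = 0 := by
      simp [eLaplacian, iteratedFDeriv_const_of_ne two_ne_zero]
    rw [hg, eLaplacian_add contDiffAt_const (contDiffAt_norm_sub_sq_rpow hy _), h1,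
      eLaplacian_norm_sub_sq_rpow hy, zero_add]
    have h2 : 0 < ‖y - a‖ ^ 2 := pow_pos (norm_pos_iff.2 (sub_ne_zero.2 hy)) 2
    have h3 : (3 : ℝ) ≤ n := by exact_mod_cast hn
    refine mul_neg_of_neg_of_pos ?_ (Real.rpow_pos_of_pos h2 _)
    nlinarith
  have hΔf : ∀ y, y ≠ 0 → eLaplacian f y = 0 := fun y hy => by
    rw [hf, eLaplacian_const_mul _ (contDiffAt_norm_sub_sq_rpow hy _),
      eLaplacian_norm_sub_sq_rpow hy, hnp]
    ring
  have hfR : ∀ y, R ≤ ‖y‖ → f y ≤ m * (R / ‖y‖) := fun y hy => by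
    rw [hfe y (hne y hy)]
    have hy0 : 0 < ‖y‖ := by linarith
    refine mul_le_mul_of_nonneg_left ?_ hm.le
    exact pow_le_of_le_one (by positivity) (by rw [div_le_one hy0]; exact hy) (by omega)
  have hfm : ∀ y, R ≤ ‖y‖ → f y ≤ m := fun y hy => by
    refine (hfR y hy).trans (mul_le_of_le_one_right hm.le ?_)
    rw [div_le_one (by linarith)]; exact hy
  have key : ∀ ε : ℝ, 0 < ε → f z₀ ≤ w z₀ + ε * g z₀ := by
    intro ε hε
    have hd0 : 0 < ‖z₀ - a‖ := norm_pos_iff.2 (sub_ne_zero.2 hz₀a)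
    obtain ⟨ρ, hρ0, hρz, hρ⟩ : ∃ ρ : ℝ, 0 < ρ ∧ ρ ≤ ‖z₀ - a‖ ∧
        m < ε * (ρ ^ 2) ^ (-(1 / 4) : ℝ) := by
      have h1 : Tendsto (fun ρ : ℝ => ε * (ρ ^ 2) ^ (-(1 / 4) : ℝ)) (𝓝[>] 0) atTop := by
        refine Tendsto.const_mul_atTop hε ?_
        refine (tendsto_rpow_neg_nhdsGT_zero (by norm_num)).comp ?_
        refine tendsto_nhdsWithin_iff.2 ⟨?_, ?_⟩
        · have : Tendsto (fun ρ : ℝ => ρ ^ 2) (𝓝 0) (𝓝 (0 ^ 2)) := (continuous_pow 2).tendsto 0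
          simpa using this.mono_left nhdsWithin_le_nhds
        · filter_upwards [self_mem_nhdsWithin] with ρ hρ
          exact mem_Ioi.2 (pow_pos (mem_Ioi.1 hρ) 2)
      obtain ⟨ρ, ⟨h2, h3⟩, h4⟩ := ((h1.eventually_gt_atTop m).and
        (Ioo_mem_nhdsGT hd0)).exists.imp fun ρ h => (⟨h.2, h.1⟩ : ρ ∈ Ioo 0 ‖z₀ - a‖ ∧ _)
      exact ⟨ρ, h2, h3.le, h4⟩
    set M := ‖z₀‖ + m * R / ε with hM
    have hMR : R ≤ M := by
      have : 0 ≤ m * R / ε := by positivity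
      linarith
    set K : Set (EuclideanSpace ℝ (Fin n)) :=
      {y | R ≤ ‖y‖} ∩ {y | ρ ≤ ‖y - a‖} ∩ Metric.closedBall 0 M with hK
    have hKc : IsCompact K := by
      refine (isCompact_closedBall _ _).inter_left (IsClosed.inter ?_ ?_)
      · exact isClosed_le continuous_const continuous_norm
      · exact isClosed_le continuous_const (by fun_prop)
    have hKa : ∀ y ∈ K, y ≠ a := fun y hy h => by
      have : ρ ≤ ‖y - a‖ := hy.1.2
      rw [h, sub_self, norm_zero] at this
      linarith
    have hcd : ∀ y ∈ K, ContDiffAt ℝ 2 (fun y => w y - f y + ε * g y) y := fun y hy =>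
      ((hw y hy.1.1 (hKa y hy)).sub (hfd y (hne y hy.1.1))).add
        (contDiffAt_const.mul (hgd y (hKa y hy)))
    have hpos := nonneg_of_strict_supersolution (w := fun y => w y - f y + ε * g y) (φ := g) hKc
      (fun y hy => (hcd y hy).continuousAt.continuousWithinAt)
      (fun y hy => (hgd y (hKa y hy)).continuousAt.continuousWithinAt)
      (fun y _ => by linarith [hgpos y]) ?_ z₀ ⟨⟨hz₀, hρz⟩, ?_⟩
    · linarith
    · intro y hy hneg
      have hyR : R ≤ ‖y‖ := hy.1.1
      have hyρ : ρ ≤ ‖y - a‖ := hy.1.2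
      have hyM : ‖y‖ ≤ M := by simpa using hy.2
      have hya := hKa y hy
      have hy0 := hne y hyR
      have hw0y := hw0 y hyR hya
      have hεg : 0 < ε * g y := mul_pos hε (by linarith [hgpos y])
      have h1 : R < ‖y‖ := by
        refine lt_of_le_of_ne hyR fun h => ?_
        have := hb y h.symm hya
        have := hfm y hyR
        linarith
      have h2 : ρ < ‖y - a‖ := by
        refine lt_of_le_of_ne hyρ fun h => ?_
        have h3 := hfm y hyR
        have h4 : ε * g y = ε + ε * (ρ ^ 2) ^ (-(1 / 4) : ℝ) := by
          simp only [hg, ← h]; ring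
        linarith
      have h3 : ‖y‖ < M := by
        refine lt_of_le_of_ne hyM fun h => ?_
        have h4 := hfR y hyR
        have h5 : m * (R / ‖y‖) ≤ ε := by
          rw [← mul_div_assoc, div_le_iff₀ (by linarith), h, hM, mul_add, mul_div_cancel₀ _ hε.ne']
          have : 0 ≤ ε * ‖z₀‖ := by positivity
          linarith
        have h6 : ε ≤ ε * g y := le_mul_of_one_le_right hε.le (hgpos y)
        linarith
      refine ⟨?_, hcd y hy, hgd y hya, 0, ?_, by simpa using hΔg y hya⟩
      · refine mem_of_superset (((isOpen_lt continuous_const continuous_norm).inter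
          ((isOpen_lt continuous_const (by fun_prop)).inter
          (isOpen_lt continuous_norm continuous_const))).mem_nhds ⟨h1, h2, h3⟩ :
          {y : EuclideanSpace ℝ (Fin n) | R < ‖y‖} ∩ ({y | ρ < ‖y - a‖} ∩ {y | ‖y‖ < M}) ∈ 𝓝 y) ?_
        rintro x ⟨hx1, hx2, hx3⟩
        refine ⟨⟨(show R < ‖x‖ from hx1).le, (show ρ < ‖x - a‖ from hx2).le⟩, ?_⟩
        simpa using (show ‖x‖ < M from hx3).le
      · rw [eLaplacian_add ((hw y hyR hya).sub (hfd y hy0)) (contDiffAt_const.mul (hgd y hya)),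
          eLaplacian_sub (hw y hyR hya) (hfd y hy0), eLaplacian_const_mul _ (hgd y hya),
          hΔf y hy0]
        nlinarith [hΔ y hyR hya, hΔg y hya]
    · have : 0 ≤ m * R / ε := by positivity
      simp only [Metric.mem_closedBall, dist_zero_right]
      linarith
  rw [← hfe z₀ (hne z₀ hz₀)]
  refine le_of_forall_pos_le_add fun ε hε => ?_
  have hg0 : 0 < g z₀ := by linarith [hgpos z₀]
  have := key (ε / g z₀) (by positivity)
  rwa [div_mul_cancel₀ _ hg0.ne'] at this

end Exterior

section MovingSpheres

variable {n : ℕ}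

/-- `v` is a positive solution of the critical equation with inverse-square potential
centred at `a`. -/
structure IsHardySolution (c : ℝ) (a : EuclideanSpace ℝ (Fin n))
    (v : EuclideanSpace ℝ (Fin n) → ℝ) : Prop where
  contDiffAt : ∀ z, z ≠ a → ContDiffAt ℝ 2 v z
  pos : ∀ z, z ≠ a → 0 < v z
  eq : ∀ z, z ≠ a → eLaplacian v z + c / ‖z - a‖ ^ 2 * v z
    + v z ^ (((n : ℝ) + 2) / ((n : ℝ) - 2)) = 0

lemma norm_inversion {l : ℝ} {z : EuclideanSpace ℝ (Fin n)} (hz : z ≠ 0) :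
    ‖(l ^ 2 / ‖z‖ ^ 2) • z‖ = l ^ 2 / ‖z‖ := by
  have hz' : ‖z‖ ≠ 0 := norm_ne_zero_iff.2 hz
  rw [norm_smul, Real.norm_of_nonneg (by positivity)]
  field_simp

lemma norm_inversion_le {l : ℝ} {z : EuclideanSpace ℝ (Fin n)} (hl : 0 ≤ l) (hz : z ≠ 0)
    (hlz : l ≤ ‖z‖) : ‖(l ^ 2 / ‖z‖ ^ 2) • z‖ ≤ l := by
  have hz' : 0 < ‖z‖ := norm_pos_iff.2 hz
  rw [norm_inversion hz, div_le_iff₀ hz']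
  nlinarith

lemma inversion_ne {l : ℝ} {a z : EuclideanSpace ℝ (Fin n)} (hl : 0 ≤ l) (hla : l < ‖a‖)
    (hz : z ≠ 0) (hlz : l ≤ ‖z‖) : (l ^ 2 / ‖z‖ ^ 2) • z ≠ a := fun h => by
  have := norm_inversion_le hl hz hlz
  rw [h] at this
  linarith

lemma kelvin_of_norm_eq {l : ℝ} (v : EuclideanSpace ℝ (Fin n) → ℝ)
    {z : EuclideanSpace ℝ (Fin n)} (hz : z ≠ 0) (h : ‖z‖ = l) : kelvin v l z = v z := by
  have hz' : ‖z‖ ≠ 0 := norm_ne_zero_iff.2 hz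
  rw [kelvin, ← h, div_self hz', div_self (pow_ne_zero 2 hz')]
  simp

/-- The transformed potential is strictly smaller than the original one outside the sphere. -/
lemma kelvin_potential_lt {c l : ℝ} (hc : 0 < c) {a z : EuclideanSpace ℝ (Fin n)} (hl : 0 ≤ l)
    (hla : l < ‖a‖) (hlz : l < ‖z‖) (hza : z ≠ a) :
    (l / ‖z‖) ^ 4 * (c / ‖(l ^ 2 / ‖z‖ ^ 2) • z - a‖ ^ 2) < c / ‖z - a‖ ^ 2 := by
  have hr : 0 < ‖z‖ := by linarith
  have hz : z ≠ 0 := norm_pos_iff.1 hr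
  have hd : 0 < ‖z - a‖ ^ 2 := pow_pos (norm_pos_iff.2 (sub_ne_zero.2 hza)) 2
  have hd' : 0 < ‖(l ^ 2 / ‖z‖ ^ 2) • z - a‖ ^ 2 :=
    pow_pos (norm_pos_iff.2 (sub_ne_zero.2 (inversion_ne hl hla hz hlz.le))) 2
  have e1 : ‖z - a‖ ^ 2 = ‖z‖ ^ 2 - 2 * inner ℝ z a + ‖a‖ ^ 2 := norm_sub_sq_real z a
  have e2 : ‖z‖ ^ 4 * ‖(l ^ 2 / ‖z‖ ^ 2) • z - a‖ ^ 2 =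
      l ^ 4 * ‖z‖ ^ 2 - 2 * l ^ 2 * ‖z‖ ^ 2 * inner ℝ z a + ‖z‖ ^ 4 * ‖a‖ ^ 2 := by
    rw [norm_sub_sq_real, norm_inversion hz, real_inner_smul_left]
    field_simp
  have hin : inner ℝ z a ≤ ‖z‖ * ‖a‖ := real_inner_le_norm z a
  have key : l ^ 4 * ‖z - a‖ ^ 2 < ‖z‖ ^ 4 * ‖(l ^ 2 / ‖z‖ ^ 2) • z - a‖ ^ 2 := by
    rw [e1, e2]
    have h1 : 0 < ‖z‖ ^ 2 - l ^ 2 := by nlinarith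
    have h2 : 0 < (‖z‖ ^ 2 + l ^ 2) * ‖a‖ ^ 2 - 2 * l ^ 2 * (‖z‖ * ‖a‖) := by
      have h3 : 0 < (‖z‖ - l) ^ 2 * ‖a‖ ^ 2 := by
        have : 0 < ‖z‖ - l := by linarith
        have : 0 < ‖a‖ := by linarith
        positivity
      have h4 : 0 ≤ 2 * l * ‖z‖ * ‖a‖ * (‖a‖ - l) := by
        have : 0 ≤ ‖a‖ - l := by linarith
        positivity
      nlinarith
    have h5 : 0 < (‖z‖ ^ 2 + l ^ 2) * ‖a‖ ^ 2 - 2 * l ^ 2 * inner ℝ z a := by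
      nlinarith [mul_le_mul_of_nonneg_left hin (by positivity : 0 ≤ 2 * l ^ 2)]
    nlinarith [mul_pos h1 h5]
  rw [div_pow, div_mul_div_comm, div_lt_div_iff₀ (by positivity) hd]
  nlinarith [mul_lt_mul_of_pos_left key hc]

variable {c : ℝ} {a : EuclideanSpace ℝ (Fin n)} {v : EuclideanSpace ℝ (Fin n) → ℝ}

lemma IsHardySolution.kelvin_nonneg (hv : IsHardySolution c a v) {l : ℝ} (hl : 0 ≤ l)
    (hla : l < ‖a‖) {z : EuclideanSpace ℝ (Fin n)} (hz : z ≠ 0) (hlz : l ≤ ‖z‖) :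
    0 ≤ kelvin v l z := by
  have := (hv.pos _ (inversion_ne hl hla hz hlz)).le
  unfold kelvin
  positivity

lemma IsHardySolution.contDiffAt_kelvin (hv : IsHardySolution c a v) {l : ℝ} (hl : 0 ≤ l)
    (hla : l < ‖a‖) {z : EuclideanSpace ℝ (Fin n)} (hz : z ≠ 0) (hlz : l ≤ ‖z‖) :
    ContDiffAt ℝ 2 (kelvin v l) z :=
  _root_.contDiffAt_kelvin hz (hv.contDiffAt _ (inversion_ne hl hla hz hlz))

/-- The equation satisfied by the Kelvin transform of a solution. -/
lemma IsHardySolution.eLaplacian_kelvin (hn : 3 ≤ n) (hv : IsHardySolution c a v) {l : ℝ}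
    (hl : 0 ≤ l) (hla : l < ‖a‖) {z : EuclideanSpace ℝ (Fin n)} (hz : z ≠ 0) (hlz : l ≤ ‖z‖) :
    eLaplacian (kelvin v l) z =
      -((l / ‖z‖) ^ 4 * (c / ‖(l ^ 2 / ‖z‖ ^ 2) • z - a‖ ^ 2) * kelvin v l z) -
        kelvin v l z ^ (((n : ℝ) + 2) / ((n : ℝ) - 2)) := by
  have hne := inversion_ne hl hla hz hlz
  rw [_root_.eLaplacian_kelvin (by omega) hz (hv.contDiffAt _ hne)]
  have h1 := hv.eq _ hne
  have hpos := hv.pos _ hne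
  set y := (l ^ 2 / ‖z‖ ^ 2) • z
  have hn2 : ((n - 2 : ℕ) : ℝ) = (n : ℝ) - 2 := by rw [Nat.cast_sub (by omega)]; norm_num
  have hn3 : (n : ℝ) - 2 ≠ 0 := by
    have : (3 : ℝ) ≤ n := by exact_mod_cast hn
    linarith
  have hq : 0 ≤ l / ‖z‖ := by positivity
  have h2 : kelvin v l z ^ (((n : ℝ) + 2) / ((n : ℝ) - 2)) =
      (l / ‖z‖) ^ (n + 2) * v y ^ (((n : ℝ) + 2) / ((n : ℝ) - 2)) := by
    rw [kelvin, Real.mul_rpow (by positivity) hpos.le, ← Real.rpow_natCast, ← Real.rpow_mul hq,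
      hn2, mul_div_cancel₀ _ hn3, ← Real.rpow_natCast]
    push_cast
    rfl
  rw [h2, kelvin]
  have h3 : (l / ‖z‖) ^ (n + 2) = (l / ‖z‖) ^ 4 * (l / ‖z‖) ^ (n - 2) := by
    rw [← pow_add]; congr 1; omega
  have h4 : eLaplacian v y = -(c / ‖y - a‖ ^ 2 * v y) - v y ^ (((n : ℝ) + 2) / ((n : ℝ) - 2)) := by
    linarith
  rw [h4, h3]
  ring

lemma one_le_exponent (hn : 3 ≤ n) : 1 ≤ ((n : ℝ) + 2) / ((n : ℝ) - 2) := by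
  have : (3 : ℝ) ≤ n := by exact_mod_cast hn
  rw [one_le_div (by linarith)]
  linarith

/-- Where `v` dominates its Kelvin transform, the difference is strictly superharmonic. -/
lemma IsHardySolution.eLaplacian_sub_kelvin_neg (hn : 3 ≤ n) (hc : 0 < c)
    (hv : IsHardySolution c a v) {l : ℝ}
    (hl : 0 ≤ l) (hla : l < ‖a‖) {z : EuclideanSpace ℝ (Fin n)} (hza : z ≠ a) (hlz : l < ‖z‖)
    (hle : kelvin v l z ≤ v z) : eLaplacian (fun y => v y - kelvin v l y) z < 0 := by
  have hz : z ≠ 0 := norm_pos_iff.1 (by linarith)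
  have hk := hv.kelvin_nonneg hl hla hz hlz.le
  rw [eLaplacian_sub (hv.contDiffAt z hza) (hv.contDiffAt_kelvin hl hla hz hlz.le),
    hv.eLaplacian_kelvin hn hl hla hz hlz.le]
  have h1 := hv.eq z hza
  have h2 := kelvin_potential_lt hc hl hla hlz hza
  have h3 := Real.rpow_le_rpow hk hle (by linarith [one_le_exponent hn] :
    (0 : ℝ) ≤ ((n : ℝ) + 2) / ((n : ℝ) - 2))
  have h4 := mul_lt_mul_of_pos_right h2 (hv.pos z hza)
  have h5 : (l / ‖z‖) ^ 4 * (c / ‖(l ^ 2 / ‖z‖ ^ 2) • z - a‖ ^ 2) * kelvin v l z ≤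
      (l / ‖z‖) ^ 4 * (c / ‖(l ^ 2 / ‖z‖ ^ 2) • z - a‖ ^ 2) * v z :=
    mul_le_mul_of_nonneg_left hle (by positivity)
  linarith

lemma rpow_sub_rpow_le {x y p : ℝ} (hx : 0 ≤ x) (hxy : x ≤ y) (hp : 1 ≤ p) :
    y ^ p - x ^ p ≤ p * y ^ (p - 1) * (y - x) := by
  rcases (hx.trans hxy).eq_or_lt with h | hy
  · have : x = 0 := by linarith
    simp [← h, this]
  have h1 := one_add_mul_self_le_rpow_one_add (s := x / y - 1) (p := p)
    (by have : 0 ≤ x / y := by positivity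
        linarith) hp
  rw [add_sub_cancel, Real.div_rpow hx hy.le, le_div_iff₀ (Real.rpow_pos_of_pos hy p)] at h1
  have h2 : y ^ p = y ^ (p - 1) * y := by rw [← Real.rpow_add_one hy.ne']; congr 1; ring
  have h3 : (1 + p * (x / y - 1)) * y ^ p = y ^ p - p * y ^ (p - 1) * (y - x) := by
    rw [h2]; field_simp; ring
  linarith

/-- A linear differential inequality for the difference where it is negative. -/
lemma IsHardySolution.eLaplacian_sub_kelvin_le (hn : 3 ≤ n) (hc : 0 < c)
    (hv : IsHardySolution c a v) {l : ℝ}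
    (hl : 0 ≤ l) (hla : l < ‖a‖) {z : EuclideanSpace ℝ (Fin n)} (hza : z ≠ a) (hlz : l < ‖z‖)
    (hlt : v z < kelvin v l z) {V N : ℝ} (hV : c / ‖z - a‖ ^ 2 ≤ V) (hN : kelvin v l z ≤ N) :
    eLaplacian (fun y => v y - kelvin v l y) z +
      (V + ((n : ℝ) + 2) / ((n : ℝ) - 2) * N ^ (((n : ℝ) + 2) / ((n : ℝ) - 2) - 1)) *
        (v z - kelvin v l z) ≤ 0 := by
  have hz : z ≠ 0 := norm_pos_iff.1 (by linarith)
  have hk := hv.kelvin_nonneg hl hla hz hlz.le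
  rw [eLaplacian_sub (hv.contDiffAt z hza) (hv.contDiffAt_kelvin hl hla hz hlz.le),
    hv.eLaplacian_kelvin hn hl hla hz hlz.le]
  have h1 := hv.eq z hza
  have h2 := kelvin_potential_lt hc hl hla hlz hza
  have hp := one_le_exponent hn
  have hvz := hv.pos z hza
  set p := ((n : ℝ) + 2) / ((n : ℝ) - 2)
  have h3 := rpow_sub_rpow_le hvz.le hlt.le hp
  have h4 : kelvin v l z ^ (p - 1) ≤ N ^ (p - 1) := Real.rpow_le_rpow hk hN (by linarith)
  have h5 : p * kelvin v l z ^ (p - 1) * (kelvin v l z - v z) ≤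
      p * N ^ (p - 1) * (kelvin v l z - v z) := by
    refine mul_le_mul_of_nonneg_right (mul_le_mul_of_nonneg_left h4 (by linarith)) (by linarith)
  have h6 := mul_le_mul_of_nonneg_right h2.le hk
  have h7 := mul_le_mul_of_nonneg_right hV (by linarith : 0 ≤ kelvin v l z - v z)
  linarith

end MovingSpheres

section Continuation

variable {n : ℕ} {c : ℝ} {a : EuclideanSpace ℝ (Fin n)} {v : EuclideanSpace ℝ (Fin n) → ℝ}

/-- `v` dominates its Kelvin transform outside the ball of radius `l`. -/
def DominatesKelvin (a : EuclideanSpace ℝ (Fin n)) (v : EuclideanSpace ℝ (Fin n) → ℝ)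
    (l : ℝ) : Prop :=
  ∀ z, l ≤ ‖z‖ → z ≠ 0 → z ≠ a → kelvin v l z ≤ v z

lemma DominatesKelvin.lt (hn : 3 ≤ n) (hc : 0 < c) (hv : IsHardySolution c a v) {l : ℝ}
    (hl : 0 ≤ l) (hla : l < ‖a‖) (hdom : DominatesKelvin a v l)
    {z : EuclideanSpace ℝ (Fin n)} (hza : z ≠ a) (hlz : l < ‖z‖) : kelvin v l z < v z := by
  have hz : z ≠ 0 := norm_pos_iff.1 (by linarith)
  have hle := hdom z hlz.le hz hza
  refine lt_of_le_of_ne hle fun heq => ?_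
  have hmin : IsLocalMin (fun y => v y - kelvin v l y) z := by
    filter_upwards [continuous_norm.continuousAt.eventually (lt_mem_nhds hlz),
      isOpen_ne.mem_nhds hz, isOpen_ne.mem_nhds hza] with y h1 h2 h3
    have := hdom y (le_of_lt h1) h2 h3
    simp only [heq, sub_self]
    linarith
  have h1 := eLaplacian_nonneg_of_isLocalMin
    ((hv.contDiffAt z hza).sub (hv.contDiffAt_kelvin hl hla hz hlz.le)) hmin
  have h2 := hv.eLaplacian_sub_kelvin_neg hn hc hl hla hza hlz hle
  linarith

/-- Extension of domination across a thin annulus. -/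
lemma IsHardySolution.exists_annulus (hn : 3 ≤ n) (hc : 0 < c) (hv : IsHardySolution c a v)
    {l₀ : ℝ} (hl₀ : 0 ≤ l₀) (hla : l₀ < ‖a‖) :
    ∃ R, l₀ < R ∧ R < ‖a‖ ∧ ∀ l, l₀ < l → l < R →
      (∀ z, ‖z‖ = R → kelvin v l z ≤ v z) →
      ∀ z, l ≤ ‖z‖ → ‖z‖ ≤ R → kelvin v l z ≤ v z := by
  obtain ⟨R₁, h1, h2⟩ := exists_between hla
  have hne : ∀ z : EuclideanSpace ℝ (Fin n), ‖z‖ ≤ R₁ → z ≠ a := fun z hz h => by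
    rw [h] at hz; linarith
  obtain ⟨N, hN⟩ := (isCompact_closedBall (0 : EuclideanSpace ℝ (Fin n)) R₁).exists_bound_of_continuousOn
    (f := v) fun z hz =>
      (hv.contDiffAt z (hne z (by simpa using hz))).continuousAt.continuousWithinAt
  have hN0 : 0 ≤ N := (norm_nonneg _).trans
    (hN 0 (Metric.mem_closedBall_self (by linarith)))
  set p := ((n : ℝ) + 2) / ((n : ℝ) - 2) with hp
  have hp1 : 1 ≤ p := one_le_exponent hn
  set κ := c / (‖a‖ - R₁) ^ 2 + p * N ^ (p - 1) with hκ
  have hκ0 : 0 ≤ κ := by positivity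
  set A := κ + 1 with hA
  have hA0 : 0 < A := by linarith
  set R := min R₁ (√(l₀ ^ 2 + 1 / A)) with hR
  have hl₀R : l₀ < R := by
    refine lt_min h1 (Real.lt_sqrt_of_sq_lt ?_)
    have : 0 < 1 / A := by positivity
    linarith
  have hRR₁ : R ≤ R₁ := min_le_left _ _
  have hR0 : 0 < R := by linarith
  have hRsq : R ^ 2 ≤ l₀ ^ 2 + 1 / A := by
    rw [← Real.sq_sqrt (show 0 ≤ l₀ ^ 2 + 1 / A by positivity)]
    exact pow_le_pow_left₀ hR0.le (min_le_right _ _) 2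
  refine ⟨R, hl₀R, by linarith, fun l hll hlR hbd z hlz hzR => ?_⟩
  have hl0 : 0 < l := by linarith
  set K : Set (EuclideanSpace ℝ (Fin n)) := {y | l ≤ ‖y‖} ∩ Metric.closedBall 0 R with hK
  have hKc : IsCompact K :=
    (isCompact_closedBall _ _).inter_left (isClosed_le continuous_const continuous_norm)
  have hKl : ∀ y ∈ K, l ≤ ‖y‖ := fun y hy => hy.1
  have hKR : ∀ y ∈ K, ‖y‖ ≤ R := fun y hy => by simpa using hy.2
  have hK0 : ∀ y ∈ K, y ≠ 0 := fun y hy => norm_pos_iff.1 (by linarith [hKl y hy])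
  have hKa : ∀ y ∈ K, y ≠ a := fun y hy => hne y ((hKR y hy).trans hRR₁)
  have hwd : ∀ y ∈ K, ContDiffAt ℝ 2 (fun y => v y - kelvin v l y) y := fun y hy =>
    (hv.contDiffAt y (hKa y hy)).sub
      (hv.contDiffAt_kelvin hl0.le (by linarith) (hK0 y hy) (hKl y hy))
  set φ : EuclideanSpace ℝ (Fin n) → ℝ := fun y => 2 + A * l₀ ^ 2 - A * ‖y - 0‖ ^ 2 with hφ
  have hφd : ∀ y, ContDiffAt ℝ 2 φ y := fun y =>
    contDiffAt_const.sub (contDiffAt_const.mul ((contDiffAt_id.sub contDiffAt_const).norm_sq ℝ))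
  have hφΔ : ∀ y, eLaplacian φ y = -(2 * n * A) := fun y => by
    have h3 : ∀ s : ℝ, HasDerivAt (fun s : ℝ => 2 + A * l₀ ^ 2 - A * s) (-A) s := fun s => by
      simpa using ((hasDerivAt_id s).const_mul A).const_sub (2 + A * l₀ ^ 2)
    rw [eLaplacian_comp_norm_sub_sq (g := fun s => 2 + A * l₀ ^ 2 - A * s) (g' := fun _ => -A)
      (g'' := 0) (hφd y) (Eventually.of_forall h3) (hasDerivAt_const _ _)]
    ring
  have hφ1 : ∀ y ∈ K, 1 ≤ φ y := fun y hy => by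
    simp only [hφ, sub_zero]
    have h3 : ‖y‖ ^ 2 ≤ R ^ 2 := pow_le_pow_left₀ (norm_nonneg _) (hKR y hy) 2
    have h4 : A * ‖y‖ ^ 2 ≤ A * (l₀ ^ 2 + 1 / A) := mul_le_mul_of_nonneg_left (h3.trans hRsq) hA0.le
    have h5 : A * (1 / A) = 1 := by field_simp
    linarith
  have hφ2 : ∀ y ∈ K, φ y ≤ 2 := fun y hy => by
    simp only [hφ, sub_zero]
    have h3 : l₀ ^ 2 ≤ ‖y‖ ^ 2 := pow_le_pow_left₀ hl₀ (hll.le.trans (hKl y hy)) 2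
    linarith [mul_le_mul_of_nonneg_left h3 hA0.le]
  have hmain := nonneg_of_strict_supersolution (w := fun y => v y - kelvin v l y) (φ := φ) hKc
    (fun y hy => (hwd y hy).continuousAt.continuousWithinAt)
    (fun y _ => (hφd y).continuousAt.continuousWithinAt)
    (fun y hy => by linarith [hφ1 y hy]) ?_ z ⟨hlz, by simpa using hzR⟩
  · linarith
  · intro y hy hneg
    have hy0 := hK0 y hy
    have hya := hKa y hy
    have hyl : l < ‖y‖ := by
      refine lt_of_le_of_ne (hKl y hy) fun h => ?_
      rw [kelvin_of_norm_eq v hy0 h.symm, sub_self] at hneg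
      exact lt_irrefl _ hneg
    have hyR : ‖y‖ < R := lt_of_le_of_ne (hKR y hy) fun h => by linarith [hbd y h]
    refine ⟨?_, hwd y hy, hφd y, κ, ?_, ?_⟩
    · refine mem_of_superset (((isOpen_lt continuous_const continuous_norm).inter
        (isOpen_lt continuous_norm continuous_const)).mem_nhds ⟨hyl, hyR⟩ :
        {y : EuclideanSpace ℝ (Fin n) | l < ‖y‖} ∩ {y | ‖y‖ < R} ∈ 𝓝 y) ?_
      rintro x ⟨hx1, hx2⟩
      exact ⟨(show l < ‖x‖ from hx1).le, by simpa using (show ‖x‖ < R from hx2).le⟩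
    · refine hv.eLaplacian_sub_kelvin_le hn hc hl0.le (by linarith) hya hyl (by linarith) ?_ ?_
      · have h3 : ‖a‖ - R₁ ≤ ‖y - a‖ := by
          have := norm_sub_norm_le a y
          rw [norm_sub_rev] at this
          linarith
        have h4 : 0 < ‖a‖ - R₁ := by linarith
        exact div_le_div_of_nonneg_left hc.le (by positivity) (pow_le_pow_left₀ h4.le h3 2)
      · have h3 := norm_inversion_le hl0.le hy0 hyl.le
        have h4 := hN ((l ^ 2 / ‖y‖ ^ 2) • y) (by
          rw [Metric.mem_closedBall, dist_zero_right]
          linarith)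
        have h5 : (l / ‖y‖) ^ (n - 2) ≤ 1 := by
          refine pow_le_one₀ (by positivity) ?_
          rw [div_le_one (by linarith)]
          exact hyl.le
        have h6 : v ((l ^ 2 / ‖y‖ ^ 2) • y) ≤ N := (le_abs_self _).trans h4
        calc kelvin v l y ≤ (l / ‖y‖) ^ (n - 2) * N :=
              mul_le_mul_of_nonneg_left h6 (by positivity)
          _ ≤ 1 * N := mul_le_mul_of_nonneg_right h5 hN0
          _ = N := one_mul N
    · rw [hφΔ]
      have h3 : (3 : ℝ) ≤ n := by exact_mod_cast hn
      nlinarith [mul_le_mul_of_nonneg_left (hφ2 y hy) hκ0]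

lemma kelvin_eq_mul (v : EuclideanSpace ℝ (Fin n) → ℝ) (l : ℝ) (z : EuclideanSpace ℝ (Fin n)) :
    kelvin v l z = (1 / ‖z‖) ^ (n - 2) * (l ^ (n - 2) * v (l ^ 2 • (1 / ‖z‖ ^ 2) • z)) := by
  rw [kelvin, smul_smul, ← mul_assoc, ← mul_pow]
  congr 3 <;> ring

/-- Far from the sphere, domination persists for slightly larger radii. -/
lemma DominatesKelvin.exists_exterior (hn : 3 ≤ n) (hc : 0 < c) (hv : IsHardySolution c a v)
    {l₀ R : ℝ} (hl₀ : 0 ≤ l₀) (hR : l₀ < R) (hRa : R < ‖a‖) (hdom : DominatesKelvin a v l₀) :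
    ∃ ε > 0, ∀ l, l₀ ≤ l → l < l₀ + ε → l ≤ R → ∀ z, R ≤ ‖z‖ → z ≠ a →
      kelvin v l z ≤ v z := by
  have hR0 : 0 < R := by linarith
  have hz0 : ∀ z : EuclideanSpace ℝ (Fin n), R ≤ ‖z‖ → z ≠ 0 := fun z hz =>
    norm_pos_iff.1 (by linarith)
  have hwd : ∀ z, R ≤ ‖z‖ → z ≠ a → ContDiffAt ℝ 2 (fun y => v y - kelvin v l₀ y) z :=
    fun z hz hza => (hv.contDiffAt z hza).sub
      (hv.contDiffAt_kelvin hl₀ (by linarith) (hz0 z hz) (by linarith))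
  have hlt : ∀ z, R ≤ ‖z‖ → z ≠ a → kelvin v l₀ z < v z := fun z hz hza =>
    hdom.lt hn hc hv hl₀ (by linarith) hza (by linarith)
  have hsph : ∀ z ∈ Metric.sphere (0 : EuclideanSpace ℝ (Fin n)) R, R ≤ ‖z‖ ∧ z ≠ a := by
    intro z hz
    have h : ‖z‖ = R := by simpa using hz
    exact ⟨h.ge, fun h' => by rw [h'] at h; linarith⟩
  obtain ⟨m, hm, hmz⟩ := (isCompact_sphere (0 : EuclideanSpace ℝ (Fin n)) R).exists_forall_le'
    (f := fun y => v y - kelvin v l₀ y) (a := 0)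
    (fun z hz => (hwd z (hsph z hz).1 (hsph z hz).2).continuousAt.continuousWithinAt)
    (fun z hz => sub_pos.2 (hlt z (hsph z hz).1 (hsph z hz).2))
  have hlow := superharmonic_lower_bound hn hR0 hm hwd
    (fun z hz hza => (sub_pos.2 (hlt z hz hza)).le)
    (fun z hz hza => (hv.eLaplacian_sub_kelvin_neg hn hc hl₀ (by linarith) hza (by linarith)
      (hlt z hz hza).le).le)
    (fun z hz _ => hmz z (by simpa using hz))
  set S : Set (ℝ × EuclideanSpace ℝ (Fin n)) := Icc l₀ R ×ˢ Metric.closedBall 0 (1 / R)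
  set G : ℝ × EuclideanSpace ℝ (Fin n) → ℝ := fun q => q.1 ^ (n - 2) * v (q.1 ^ 2 • q.2) with hG
  have hGc : ContinuousOn G S := by
    rintro ⟨l, ζ⟩ ⟨⟨h1, h2⟩, h3⟩
    have h3' : ‖ζ‖ ≤ 1 / R := by simpa using h3
    simp only at h1 h2
    have hne : l ^ 2 • ζ ≠ a := fun h => by
      have h4 : ‖l ^ 2 • ζ‖ ≤ R ^ 2 * (1 / R) := by
        rw [norm_smul, Real.norm_of_nonneg (by positivity)]
        exact mul_le_mul (pow_le_pow_left₀ (by linarith) h2 2) h3' (norm_nonneg _) (by positivity)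
      have h5 : R ^ 2 * (1 / R) = R := by field_simp
      rw [h, h5] at h4
      linarith
    have h6 : ContinuousAt v (l ^ 2 • ζ) := (hv.contDiffAt _ hne).continuousAt
    have h7 : ContinuousAt (fun q : ℝ × EuclideanSpace ℝ (Fin n) => q.1 ^ 2 • q.2) (l, ζ) := by
      fun_prop
    have h8 : ContinuousAt (fun q : ℝ × EuclideanSpace ℝ (Fin n) => q.1 ^ (n - 2)) (l, ζ) := by
      fun_prop
    exact (h8.mul (ContinuousAt.comp (f := fun q : ℝ × EuclideanSpace ℝ (Fin n) => q.1 ^ 2 • q.2)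
      h6 h7)).continuousWithinAt
  have hGu := (isCompact_Icc.prod (isCompact_closedBall _ _)).uniformContinuousOn_of_continuous hGc
  rw [Metric.uniformContinuousOn_iff] at hGu
  obtain ⟨ε, hε, hGε⟩ := hGu (m * R ^ (n - 2)) (by positivity)
  refine ⟨ε, hε, fun l h1 h2 h3 z hz hza => ?_⟩
  have hzp : 0 < ‖z‖ := by linarith
  have hζ : (1 / ‖z‖ ^ 2) • z ∈ Metric.closedBall (0 : EuclideanSpace ℝ (Fin n)) (1 / R) := by
    rw [Metric.mem_closedBall, dist_zero_right, norm_smul, Real.norm_of_nonneg (by positivity)]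
    have : 1 / ‖z‖ ^ 2 * ‖z‖ = 1 / ‖z‖ := by field_simp
    rw [this]
    exact one_div_le_one_div_of_le hR0 hz
  have h4 := hGε (l, (1 / ‖z‖ ^ 2) • z) ⟨⟨h1, h3⟩, hζ⟩ (l₀, (1 / ‖z‖ ^ 2) • z)
    ⟨⟨le_rfl, hR.le⟩, hζ⟩ (by
      rw [Prod.dist_eq, dist_self, max_eq_left dist_nonneg, Real.dist_eq,
        abs_of_nonneg (by simp only; linarith)]
      simp only
      linarith)
  rw [Real.dist_eq] at h4
  have h5 := (le_abs_self _).trans h4.le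
  have h6 := hlow z hz hza
  have h7 : kelvin v l z - kelvin v l₀ z ≤ m * (R / ‖z‖) ^ (n - 2) := by
    rw [kelvin_eq_mul, kelvin_eq_mul, ← mul_sub]
    refine (mul_le_mul_of_nonneg_left h5 (by positivity)).trans (le_of_eq ?_)
    rw [div_pow, div_pow, one_pow]
    ring
  linarith

lemma DominatesKelvin.exists_forall (hn : 3 ≤ n) (hc : 0 < c) (hv : IsHardySolution c a v)
    {l₀ : ℝ} (hl₀ : 0 ≤ l₀) (hla : l₀ < ‖a‖) (hdom : DominatesKelvin a v l₀) :
    ∃ ε > 0, ∀ l, l₀ < l → l < l₀ + ε → DominatesKelvin a v l := by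
  obtain ⟨R, h1, h2, h3⟩ := hv.exists_annulus hn hc hl₀ hla
  obtain ⟨ε, hε, h4⟩ := hdom.exists_exterior hn hc hv hl₀ h1 h2
  refine ⟨min ε (R - l₀), lt_min hε (by linarith), fun l h5 h6 z h7 _ h8 => ?_⟩
  have h9 : l < l₀ + ε := by linarith [min_le_left ε (R - l₀)]
  have h10 : l < R := by linarith [min_le_right ε (R - l₀)]
  rcases le_total R ‖z‖ with h | h
  · exact h4 l h5.le h9 h10.le z h h8
  · refine h3 l h5 h10 (fun y hy => h4 l h5.le h9 h10.le y hy.ge fun hya => ?_) z h7 h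
    rw [hya] at hy
    linarith

/-- A positive solution dominates its Kelvin transforms with respect to all spheres that do not
enclose the singularity. -/
theorem IsHardySolution.dominatesKelvin (hn : 3 ≤ n) (hc : 0 < c) (hv : IsHardySolution c a v)
    {b : ℝ} (hb : 0 ≤ b) (hba : b < ‖a‖) : DominatesKelvin a v b := by
  have hsub : Icc 0 b ⊆ {l | DominatesKelvin a v l} := by
    refine IsClosed.Icc_subset_of_forall_exists_gt ?_ ?_ ?_
    · refine isClosed_of_closure_subset fun l hl => ?_
      have hlI : l ∈ Icc 0 b := isClosed_Icc.closure_subset_iff.2 inter_subset_right hl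
      refine ⟨fun z hlz hz hza => ?_, hlI⟩
      rcases hlz.eq_or_lt with h | h
      · exact (kelvin_of_norm_eq v hz h.symm).le
      have hcont : ContinuousAt (fun t : ℝ => kelvin v t z) l := by
        have h1 : ContinuousAt v ((l ^ 2 / ‖z‖ ^ 2) • z) := (hv.contDiffAt _
          (inversion_ne hlI.1 (hlI.2.trans_lt hba) hz hlz)).continuousAt
        have h2 : ContinuousAt (fun t : ℝ => (t ^ 2 / ‖z‖ ^ 2) • z) l := by fun_prop
        exact ContinuousAt.mul (by fun_prop)
          (ContinuousAt.comp (f := fun t : ℝ => (t ^ 2 / ‖z‖ ^ 2) • z) h1 h2)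
      rw [mem_closure_iff_frequently] at hl
      by_contra! hlt
      have h3 := hcont.eventually (lt_mem_nhds hlt)
      obtain ⟨t, ⟨⟨ht, _⟩, h4⟩, h5⟩ := ((hl.and_eventually h3).and_eventually
        (gt_mem_nhds h)).exists
      exact absurd (ht z h5.le hz hza) (not_le.2 h4)
    · intro z _ _ hza
      have : kelvin v 0 z = 0 := by
        rw [kelvin, zero_div, zero_pow (by omega), zero_mul]
      rw [this]
      exact (hv.pos z hza).le
    · rintro l ⟨hl, hl0, hlb⟩ y hy
      obtain ⟨ε, hε, h⟩ := DominatesKelvin.exists_forall hn hc hv hl0 (hlb.trans hba) hl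
      have hy' : l < y := hy
      obtain ⟨t, ht1, ht2⟩ := exists_between (lt_min hy' (by linarith : l < l + ε))
      exact ⟨t, h t ht1 (ht2.trans_le (min_le_right _ _)), ht1,
        (ht2.trans_le (min_le_left _ _)).le⟩
  exact hsub ⟨hb, le_rfl⟩

end Continuation

section RadialSymmetry

variable {n : ℕ} {c : ℝ} {u : EuclideanSpace ℝ (Fin n) → ℝ}

lemma IsHardySolution.comp_add_left (hu : IsHardySolution c 0 u) (x : EuclideanSpace ℝ (Fin n)) :
    IsHardySolution c (-x) (fun z => u (x + z)) := by
  have hne : ∀ z, z ≠ -x → x + z ≠ 0 := fun z hz h => hz (eq_neg_of_add_eq_zero_right h)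
  refine ⟨fun z hz => ?_, fun z hz => hu.pos _ (hne z hz), fun z hz => ?_⟩
  · exact ContDiffAt.comp z (hu.contDiffAt _ (hne z hz)) (by fun_prop)
  · have := hu.eq _ (hne z hz)
    rw [sub_zero] at this
    rwa [eLaplacian_comp_add_left, sub_neg_eq_add, add_comm z x]

lemma IsHardySolution.pow_mul_le (hn : 3 ≤ n) (hc : 0 < c) (hu : IsHardySolution c 0 u)
    {y y' : EuclideanSpace ℝ (Fin n)} (hy : y ≠ 0) (hyy : ‖y‖ ≤ ‖y'‖) (hne : y ≠ y') {T : ℝ}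
    (hT : 1 < T) : √((T - 1) / T) ^ (n - 2) * u y' ≤ u y := by
  have hd : 0 < ‖y' - y‖ := norm_pos_iff.2 (sub_ne_zero.2 hne.symm)
  have hT0 : 0 < T := by linarith
  set d := y' - y with hdef
  have hy' : y' = y + d := by simp [hdef]
  have hz : ‖(-T) • d‖ = T * ‖d‖ := by rw [norm_smul, norm_neg, Real.norm_of_nonneg hT0.le]
  have hTd : 0 < T * ‖d‖ := by positivity
  set b := √((T - 1) / T) * (T * ‖d‖) with hb
  have hfrac : 0 < (T - 1) / T := div_pos (by linarith) hT0
  have hb2 : b ^ 2 = T * (T - 1) * ‖d‖ ^ 2 := by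
    rw [hb, mul_pow, Real.sq_sqrt hfrac.le]
    field_simp
  have hbT : b ≤ T * ‖d‖ := by
    rw [hb]
    refine mul_le_of_le_one_left hTd.le (Real.sqrt_le_one.2 ?_)
    rw [div_le_one hT0]
    linarith
  have hbx : b < ‖-(y + T • d)‖ := by
    refine lt_of_pow_lt_pow_left₀ 2 (norm_nonneg _) ?_
    have h1 : ‖y + d‖ ^ 2 = ‖y‖ ^ 2 + 2 * inner ℝ y d + ‖d‖ ^ 2 := norm_add_sq_real y d
    have h2 : ‖y‖ ^ 2 ≤ ‖y + d‖ ^ 2 := by rw [← hy']; gcongr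
    have h3 : 0 < ‖y‖ ^ 2 := pow_pos (norm_pos_iff.2 hy) 2
    rw [norm_neg, norm_add_sq_real, norm_smul, Real.norm_of_nonneg hT0.le, real_inner_smul_right,
      hb2]
    nlinarith
  have key := (hu.comp_add_left (y + T • d)).dominatesKelvin hn hc (by positivity : 0 ≤ b) hbx
    ((-T) • d) (hbT.trans_eq hz.symm) (norm_pos_iff.1 (hz.symm ▸ hTd)) (by
      intro h
      apply hy
      have h2 := congrArg (fun w => w + (y + T • d)) h
      simpa using h2)
  have e1 : b / (T * ‖d‖) = √((T - 1) / T) := by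
    rw [hb, mul_div_assoc, div_self hTd.ne', mul_one]
  have e2 : b ^ 2 / (T * ‖d‖) ^ 2 = (T - 1) / T := by
    rw [← div_pow, e1, Real.sq_sqrt hfrac.le]
  have e3 : y + T • d + ((T - 1) / T) • ((-T) • d) = y' := by
    rw [smul_smul, hy', add_assoc, ← add_smul]
    have : T + (T - 1) / T * (-T) = 1 := by field_simp; ring
    rw [this, one_smul]
  have e4 : y + T • d + (-T) • d = y := by rw [neg_smul, add_neg_cancel_right]
  simp only [kelvin] at key
  rwa [hz, e1, e2, e3, e4] at key

/-- Positive solutions on the punctured space are radially nonincreasing. -/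
lemma IsHardySolution.le_of_norm_le (hn : 3 ≤ n) (hc : 0 < c) (hu : IsHardySolution c 0 u)
    {y y' : EuclideanSpace ℝ (Fin n)} (hy : y ≠ 0) (hyy : ‖y‖ ≤ ‖y'‖) : u y' ≤ u y := by
  rcases eq_or_ne y y' with rfl | hne
  · exact le_rfl
  have hlim : Tendsto (fun T : ℝ => (T - 1) / T) atTop (𝓝 1) := by
    have h1 : Tendsto (fun T : ℝ => 1 - T⁻¹) atTop (𝓝 (1 - 0)) :=
      tendsto_const_nhds.sub tendsto_inv_atTop_zero
    rw [sub_zero] at h1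
    refine h1.congr' ?_
    filter_upwards [eventually_gt_atTop 0] with T hT
    field_simp
  have hlim' : Tendsto (fun T : ℝ => √((T - 1) / T) ^ (n - 2) * u y') atTop (𝓝 (u y')) := by
    have := ((hlim.sqrt).pow (n - 2)).mul_const (u y')
    simpa using this
  refine le_of_tendsto hlim' ?_
  filter_upwards [eventually_gt_atTop 1] with T hT
  exact hu.pow_mul_le hn hc hy hyy hne hT

lemma IsHardySolution.eq_of_norm_eq (hn : 3 ≤ n) (hc : 0 < c) (hu : IsHardySolution c 0 u)
    {x y : EuclideanSpace ℝ (Fin n)} (hx : x ≠ 0) (hy : y ≠ 0) (hxy : ‖x‖ = ‖y‖) : u x = u y :=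
  le_antisymm (hu.le_of_norm_le hn hc hy hxy.ge) (hu.le_of_norm_le hn hc hx hxy.le)

end RadialSymmetry

section RadialProfile

/-- A differential inequality satisfied by nonincreasing solutions of the radial equation,
written in the variable `s = r ^ 2`. -/
lemma deriv_le_of_radial_ode {N P c : ℝ} (hN : 0 < N) (hc : 0 < c) (hP : 0 ≤ P)
    {g g' g'' : ℝ → ℝ} (hpos : ∀ s, 0 < s → 0 < g s)
    (hanti : ∀ s t, 0 < s → s ≤ t → g t ≤ g s)
    (hg' : ∀ s, 0 < s → HasDerivAt g' (g'' s) s)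
    (hnonpos : ∀ s, 0 < s → g' s ≤ 0)
    (hode : ∀ s, 0 < s → 4 * s * g'' s + 2 * N * g' s + c / s * g s + g s ^ P = 0)
    {t : ℝ} (ht : 0 < t) : g' t ≤ -(1 / (2 * N) * g t ^ P) := by
  set φ : ℝ → ℝ := fun s => s ^ (N / 2) * (g' s + 1 / (2 * N) * g t ^ P) with hφ
  have hder : ∀ s, 0 < s → HasDerivAt φ (1 / 4 * s ^ (N / 2 - 1) *
      (g t ^ P - g s ^ P - c / s * g s)) s := by
    intro s hs
    have h1 := (Real.hasDerivAt_rpow_const (p := N / 2) (Or.inl hs.ne')).mul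
      ((hg' s hs).add_const (1 / (2 * N) * g t ^ P))
    refine h1.congr_deriv ?_
    have h2 : s ^ (N / 2) = s * s ^ (N / 2 - 1) := by
      rw [Real.rpow_sub_one hs.ne']
      field_simp
    have h3 := hode s hs
    have h4 : g t ^ P - g s ^ P - c / s * g s =
      g t ^ P + (4 * s * g'' s + 2 * N * g' s) := by linarith
    rw [h4, h2]
    field_simp
    ring
  have hφanti : AntitoneOn φ (Ioc 0 t) := by
    refine antitoneOn_of_deriv_nonpos (convex_Ioc 0 t)
      (fun s hs => (hder s hs.1).continuousAt.continuousWithinAt)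
      (fun s hs => ?_) (fun s hs => ?_)
    · rw [interior_Ioc] at hs
      exact (hder s hs.1).differentiableAt.differentiableWithinAt
    · rw [interior_Ioc] at hs
      have hs0 : 0 < s := hs.1
      rw [(hder s hs0).deriv]
      have h1 : g t ^ P ≤ g s ^ P :=
        Real.rpow_le_rpow (hpos t ht).le (hanti s t hs0 hs.2.le) hP
      have h2 : 0 < c / s * g s := mul_pos (by positivity) (hpos s hs0)
      exact mul_nonpos_of_nonneg_of_nonpos (by positivity) (by linarith)
  have hlim : Tendsto (fun s : ℝ => s ^ (N / 2) * (1 / (2 * N) * g t ^ P)) (𝓝[>] 0) (𝓝 0) := by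
    have h1 : ContinuousAt (fun s : ℝ => s ^ (N / 2)) 0 :=
      Real.continuousAt_rpow_const _ _ (Or.inr (by positivity))
    have h2 := (h1.tendsto.mono_left (nhdsWithin_le_nhds (s := Ioi 0))).mul_const
      (1 / (2 * N) * g t ^ P)
    rwa [Real.zero_rpow (by positivity), zero_mul] at h2
  have hφt : φ t ≤ 0 := by
    refine ge_of_tendsto hlim ?_
    filter_upwards [Ioc_mem_nhdsGT ht] with s hs
    refine (hφanti hs ⟨ht, le_rfl⟩ hs.2).trans ?_
    have := hnonpos s hs.1
    have h0 : (0 : ℝ) ≤ s ^ (N / 2) := Real.rpow_nonneg hs.1.le _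
    exact mul_le_mul_of_nonneg_left (by linarith) h0
  have hpow : 0 < t ^ (N / 2) := Real.rpow_pos_of_pos ht _
  by_contra! h
  have : 0 < φ t := mul_pos hpow (by linarith)
  linarith

/-- Positive functions with `g' ≤ -k g ^ (1 + q)` decay at least like `(k q s) ^ (-1 / q)`. -/
lemma le_rpow_of_deriv_le {k q : ℝ} (hk : 0 < k) (hq : 0 < q) {g g' : ℝ → ℝ}
    (hpos : ∀ s, 0 < s → 0 < g s) (hg : ∀ s, 0 < s → HasDerivAt g (g' s) s)
    (hle : ∀ s, 0 < s → g' s ≤ -(k * g s ^ (1 + q))) {t : ℝ} (ht : 0 < t) :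
    g t ≤ (k * q * t) ^ (-q⁻¹) := by
  set ψ : ℝ → ℝ := fun s => g s ^ (-q) - k * q * s with hψ
  have hder : ∀ s, 0 < s → HasDerivAt ψ (g' s * (-q) * g s ^ (-q - 1) - k * q) s := by
    intro s hs
    exact ((hg s hs).rpow_const (Or.inl (hpos s hs).ne')).sub
      (by simpa using (hasDerivAt_id s).const_mul (k * q))
  have hmono : MonotoneOn ψ (Ioi 0) := by
    refine monotoneOn_of_deriv_nonneg (convex_Ioi 0)
      (fun s hs => (hder s hs).continuousAt.continuousWithinAt)
      (fun s hs => ?_) (fun s hs => ?_)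
    · rw [interior_Ioi] at hs
      exact (hder s hs).differentiableAt.differentiableWithinAt
    · rw [interior_Ioi] at hs
      have hgs := hpos s hs
      rw [(hder s hs).deriv]
      have h1 : g s ^ (1 + q) * g s ^ (-q - 1) = 1 := by
        rw [← Real.rpow_add hgs]
        ring_nf
        exact Real.rpow_zero _
      have h2 : 0 < q * g s ^ (-q - 1) := by positivity
      have h3 := mul_le_mul_of_nonneg_right (hle s hs) h2.le
      have h4 : -(k * g s ^ (1 + q)) * (q * g s ^ (-q - 1)) = -(k * q) := by
        linear_combination -(k * q) * h1
      linarith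
  have hlim : Tendsto (fun s : ℝ => -(k * q * s)) (𝓝[>] 0) (𝓝 0) := by
    have h : Continuous fun s : ℝ => -(k * q * s) := by fun_prop
    have h1 := h.tendsto 0
    rw [mul_zero, neg_zero] at h1
    exact h1.mono_left nhdsWithin_le_nhds
  have hψt : 0 ≤ ψ t := by
    refine le_of_tendsto hlim ?_
    filter_upwards [Ioc_mem_nhdsGT ht] with s hs
    refine le_trans ?_ (hmono (mem_Ioi.2 hs.1) (mem_Ioi.2 ht) hs.2)
    have : 0 ≤ g s ^ (-q) := Real.rpow_nonneg (hpos s hs.1).le _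
    simp only [hψ]
    linarith
  have hgt := hpos t ht
  have h1 : k * q * t ≤ g t ^ (-q) := by
    simp only [hψ] at hψt
    linarith
  have h2 := Real.rpow_le_rpow_of_nonpos (by positivity) h1
    (neg_nonpos.2 (inv_nonneg.2 hq.le))
  rwa [← Real.rpow_mul hgt.le, neg_mul_neg, mul_inv_cancel₀ hq.ne', Real.rpow_one] at h2

variable {n : ℕ} {c : ℝ} {u : EuclideanSpace ℝ (Fin n) → ℝ} {e : EuclideanSpace ℝ (Fin n)}

lemma norm_sqrt_smul (he : ‖e‖ = 1) {s : ℝ} (hs : 0 ≤ s) : ‖√s • e‖ ^ 2 = s := by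
  rw [norm_smul, he, mul_one, Real.norm_of_nonneg (Real.sqrt_nonneg s), Real.sq_sqrt hs]

lemma sqrt_smul_ne_zero (he : ‖e‖ = 1) {s : ℝ} (hs : 0 < s) : √s • e ≠ 0 := fun h => by
  have := norm_sqrt_smul he hs.le
  rw [h, norm_zero] at this
  norm_num at this
  linarith

lemma IsHardySolution.contDiffAt_profile (hu : IsHardySolution c 0 u) (he : ‖e‖ = 1) {s : ℝ}
    (hs : 0 < s) : ContDiffAt ℝ 2 (fun s => u (√s • e)) s := by
  refine ContDiffAt.comp s (hu.contDiffAt _ (sqrt_smul_ne_zero he hs)) ?_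
  exact (Real.contDiffAt_sqrt hs.ne').smul contDiffAt_const

lemma IsHardySolution.eq_profile (hn : 3 ≤ n) (hc : 0 < c) (hu : IsHardySolution c 0 u)
    (he : ‖e‖ = 1) {x : EuclideanSpace ℝ (Fin n)} (hx : x ≠ 0) : u x = u (√(‖x‖ ^ 2) • e) := by
  have hx' : 0 < ‖x‖ := norm_pos_iff.2 hx
  refine hu.eq_of_norm_eq hn hc hx (sqrt_smul_ne_zero he (by positivity)) ?_
  rw [norm_smul, he, mul_one, Real.norm_of_nonneg (Real.sqrt_nonneg _),
    Real.sqrt_sq hx'.le]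

lemma IsHardySolution.hasDerivAt_profile (hu : IsHardySolution c 0 u) (he : ‖e‖ = 1) {s : ℝ}
    (hs : 0 < s) : HasDerivAt (fun s => u (√s • e)) (deriv (fun s => u (√s • e)) s) s :=
  ((hu.contDiffAt_profile he hs).differentiableAt (by norm_num)).hasDerivAt

lemma IsHardySolution.hasDerivAt_deriv_profile (hu : IsHardySolution c 0 u) (he : ‖e‖ = 1)
    {s : ℝ} (hs : 0 < s) : HasDerivAt (deriv fun s => u (√s • e))
      (deriv (deriv fun s => u (√s • e)) s) s := by
  have h : ContDiffAt ℝ 1 (deriv fun s => u (√s • e)) s :=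
    (hu.contDiffAt_profile he hs).derivWithin (by norm_num)
  exact (h.differentiableAt one_ne_zero).hasDerivAt

lemma IsHardySolution.profile_ode (hn : 3 ≤ n) (hc : 0 < c) (hu : IsHardySolution c 0 u)
    (he : ‖e‖ = 1) {s : ℝ} (hs : 0 < s) :
    4 * s * deriv (deriv fun s => u (√s • e)) s + 2 * n * deriv (fun s => u (√s • e)) s
      + c / s * u (√s • e) + u (√s • e) ^ (((n : ℝ) + 2) / ((n : ℝ) - 2)) = 0 := by
  have hz := sqrt_smul_ne_zero he hs
  have hzs : ‖√s • e - 0‖ ^ 2 = s := by rw [sub_zero, norm_sqrt_smul he hs.le]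
  have hev : u =ᶠ[𝓝 (√s • e)] fun y => u (√(‖y - 0‖ ^ 2) • e) := by
    filter_upwards [isOpen_ne.mem_nhds hz] with y hy
    rw [sub_zero]
    exact hu.eq_profile hn hc he hy
  have h1 := eLaplacian_comp_norm_sub_sq (g := fun s => u (√s • e))
    (g' := deriv fun s => u (√s • e)) (g'' := deriv (deriv fun s => u (√s • e)) s)
    (a := 0) (z := √s • e) ((hu.contDiffAt _ hz).congr_of_eventuallyEq hev.symm)
    (by
      rw [hzs]
      filter_upwards [lt_mem_nhds hs] with t ht
      exact hu.hasDerivAt_profile he ht)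
    (by
      rw [hzs]
      exact hu.hasDerivAt_deriv_profile he hs)
  have h2 : eLaplacian u (√s • e) = eLaplacian (fun y => u (√(‖y - 0‖ ^ 2) • e)) (√s • e) := by
    simp only [eLaplacian, (hev.iteratedFDeriv ℝ 2).eq_of_nhds]
  have h3 := hu.eq _ hz
  rw [h2, h1, hzs] at h3
  linarith

lemma IsHardySolution.deriv_profile_le (hn : 3 ≤ n) (hc : 0 < c) (hu : IsHardySolution c 0 u)
    (he : ‖e‖ = 1) {s : ℝ} (hs : 0 < s) : deriv (fun s => u (√s • e)) s ≤
      -(1 / (2 * n) * u (√s • e) ^ (((n : ℝ) + 2) / ((n : ℝ) - 2))) := by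
  have hanti : ∀ s t, 0 < s → s ≤ t → u (√t • e) ≤ u (√s • e) := by
    intro s t hs hst
    refine hu.le_of_norm_le hn hc (sqrt_smul_ne_zero he hs) ?_
    rw [norm_smul, norm_smul, he, mul_one, mul_one, Real.norm_of_nonneg (Real.sqrt_nonneg _),
      Real.norm_of_nonneg (Real.sqrt_nonneg _)]
    exact Real.sqrt_le_sqrt hst
  refine deriv_le_of_radial_ode (g := fun s => u (√s • e)) (by positivity) hc
    (zero_le_one.trans (one_le_exponent hn)) (fun t ht => hu.pos _ (sqrt_smul_ne_zero he ht))
    hanti (fun t ht => hu.hasDerivAt_deriv_profile he ht) (fun t ht => ?_)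
    (fun t ht => hu.profile_ode hn hc he ht) hs
  have h := (hu.hasDerivAt_profile he ht).tendsto_slope.mono_left
    (nhdsWithin_mono t (fun x (hx : t < x) => hx.ne') : 𝓝[>] t ≤ 𝓝[≠] t)
  refine le_of_tendsto h ?_
  filter_upwards [self_mem_nhdsWithin] with r hr
  have hr' : t < r := hr
  rw [slope_def_field]
  exact div_nonpos_of_nonpos_of_nonneg (by linarith [hanti t r ht hr'.le]) (by linarith)

/-- The decay rate of positive solutions. -/
lemma IsHardySolution.le_rpow_norm (hn : 3 ≤ n) (hc : 0 < c) (hu : IsHardySolution c 0 u)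
    (he : ‖e‖ = 1) {x : EuclideanSpace ℝ (Fin n)} (hx : x ≠ 0) :
    u x ≤ (1 / (2 * n) * (4 / ((n : ℝ) - 2))) ^ (-(((n : ℝ) - 2) / 4)) *
      ‖x‖ ^ (-(((n : ℝ) - 2) / 2)) := by
  have hn' : (0 : ℝ) < n - 2 := by
    have : (3 : ℝ) ≤ n := by exact_mod_cast hn
    linarith
  have hn0 : (0 : ℝ) < n := by linarith
  have hx' : 0 < ‖x‖ := norm_pos_iff.2 hx
  have hexp : ((n : ℝ) + 2) / ((n : ℝ) - 2) = 1 + 4 / ((n : ℝ) - 2) := by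
    field_simp
    ring
  have h := le_rpow_of_deriv_le (k := 1 / (2 * n)) (q := 4 / ((n : ℝ) - 2))
    (g := fun s => u (√s • e)) (by positivity) (by positivity)
    (fun t ht => hu.pos _ (sqrt_smul_ne_zero he ht)) (fun t ht => hu.hasDerivAt_profile he ht)
    (fun t ht => hexp ▸ hu.deriv_profile_le hn hc he ht) (by positivity : 0 < ‖x‖ ^ 2)
  rw [hu.eq_profile hn hc he hx]
  refine h.trans_eq ?_
  rw [Real.mul_rpow (by positivity) (by positivity), inv_div, ← Real.rpow_natCast,
    ← Real.rpow_mul hx'.le]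
  congr 2
  push_cast
  ring

lemma IsHardySolution.deriv_radial_neg (hn : 3 ≤ n) (hc : 0 < c) (hu : IsHardySolution c 0 u)
    (he : ‖e‖ = 1) {r : ℝ} (hr : 0 < r) : deriv (fun r : ℝ => u (r • e)) r < 0 := by
  have hr2 : 0 < r ^ 2 := by positivity
  have h1 : HasDerivAt (fun t : ℝ => u (√(t ^ 2) • e))
      (deriv (fun s => u (√s • e)) (r ^ 2) * (2 * r)) r :=
    HasDerivAt.comp (h₂ := fun s => u (√s • e)) r (hu.hasDerivAt_profile he hr2)
      (by simpa using hasDerivAt_pow 2 r)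
  have h2 : (fun t : ℝ => u (t • e)) =ᶠ[𝓝 r] fun t => u (√(t ^ 2) • e) := by
    filter_upwards [lt_mem_nhds hr] with t ht
    rw [Real.sqrt_sq ht.le]
  rw [h2.deriv_eq, h1.deriv]
  have h3 := hu.deriv_profile_le hn hc he hr2
  have h4 : 0 < 1 / (2 * (n : ℝ)) * u (√(r ^ 2) • e) ^ (((n : ℝ) + 2) / ((n : ℝ) - 2)) := by
    have := Real.rpow_pos_of_pos (hu.pos _ (sqrt_smul_ne_zero he hr2))
      (((n : ℝ) + 2) / ((n : ℝ) - 2))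
    positivity
  exact mul_neg_of_neg_of_pos (by linarith) (by linarith)

end RadialProfile

theorem stmt1 (n : ℕ) (hn : 3 ≤ n) (c : ℝ) (hc : 0 < c)
    (u : EuclideanSpace ℝ (Fin n) → ℝ)
    (hu : ContDiffOn ℝ (⊤ : ℕ∞) u {x | x ≠ 0})
    (hpos : ∀ x : EuclideanSpace ℝ (Fin n), x ≠ 0 → 0 < u x)
    (heq : ∀ x : EuclideanSpace ℝ (Fin n), x ≠ 0 →
      eLaplacian u x + (c / ‖x‖ ^ 2) * u x
        + u x ^ (((n : ℝ) + 2) / ((n : ℝ) - 2)) = 0) :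
    (∀ x y : EuclideanSpace ℝ (Fin n), x ≠ 0 → y ≠ 0 → ‖x‖ = ‖y‖ → u x = u y) ∧
    (∃ ubar : ℝ → ℝ,
      (∀ x : EuclideanSpace ℝ (Fin n), x ≠ 0 → u x = ubar ‖x‖) ∧
      (∀ r : ℝ, 0 < r → deriv ubar r < 0)) ∧
    (∃ C : ℝ, 0 < C ∧ ∀ x : EuclideanSpace ℝ (Fin n), x ≠ 0 →
      u x ≤ C * ‖x‖ ^ (-(((n : ℝ) - 2) / 2))) := by
  have hsol : IsHardySolution c 0 u := by
    refine ⟨fun z hz => ?_, hpos, fun z hz => ?_⟩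
    · exact (hu.contDiffAt (isOpen_ne.mem_nhds hz)).of_le
        (WithTop.coe_le_coe.2 le_top)
    · rw [sub_zero]
      exact heq z hz
  obtain ⟨e, he⟩ : ∃ e : EuclideanSpace ℝ (Fin n), ‖e‖ = 1 :=
    ⟨EuclideanSpace.single ⟨0, by omega⟩ 1, by simp⟩
  refine ⟨fun x y hx hy hxy => hsol.eq_of_norm_eq hn hc hx hy hxy,
    ⟨fun r => u (r • e), fun x hx => ?_, fun r hr => hsol.deriv_radial_neg hn hc he hr⟩,
    _, ?_, fun x hx => hsol.le_rpow_norm hn hc he hx⟩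
  · have h := hsol.eq_profile hn hc he hx
    rwa [Real.sqrt_sq (norm_nonneg x)] at h
  · have : (3 : ℝ) ≤ n := by exact_mod_cast hn
    have : (0 : ℝ) < n - 2 := by linarith
    positivity
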